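/- arXiv:1005.2754 — 12 statements merged into one kernel-verified Lean document; each statement's English description precedes it below -/
import Mathlib

section
/- Let μ be the hyperbolic area measure on the upper half-plane ℍ = {z ∈ ℂ : Im z > 0}, i.e. the measure with density (Im z)^{-2} with respect to two-dimensional Lebesgue measure. Then for every z ∈ ℍ and every r ≥ 0, the μ-measure of the hyperbolic metric ball of center z and radius r equals 2π(cosh r − 1). -/
open MeasureTheory UpperHalfPlane

noncomputable instance : MeasurableSpace UpperHalfPlane := borel _

instance : BorelSpace UpperHalfPlane := ⟨rfl⟩

/-- The hyperbolic area measure on the upper half-plane: the measure with density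
`(Im z)⁻²` with respect to two-dimensional Lebesgue measure. -/
noncomputable def hypMeasure : Measure UpperHalfPlane :=
  ((volume : Measure ℂ).comap (fun z : UpperHalfPlane => (z : ℂ))).withDensity
    fun z => ENNReal.ofReal (1 / (z.im) ^ 2)

lemma inner_int (a b : ℝ) (ha : 0 < a) (hab : a ≤ b) :
    ∫⁻ y in Set.Ioo a b, ENNReal.ofReal (1 / y ^ 2) = ENNReal.ofReal (1 / a - 1 / b) := by
  have hc : ContinuousOn (fun y : ℝ => 1 / y ^ 2) (Set.uIcc a b) := by
    rw [Set.uIcc_of_le hab]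
    intro y hy
    have : y ≠ 0 := (ha.trans_le hy.1).ne'
    exact ContinuousAt.continuousWithinAt (by fun_prop (disch := positivity))
  have hi : IntervalIntegrable (fun y : ℝ => 1 / y ^ 2) volume a b := hc.intervalIntegrable
  rw [← ofReal_integral_eq_lintegral_ofReal]
  · rw [← integral_Ioc_eq_integral_Ioo, ← intervalIntegral.integral_of_le hab]
    rw [intervalIntegral.integral_eq_sub_of_hasDerivAt (f := fun y => - y⁻¹) _ hi]
    · congr 1; ring
    · intro y hy
      rw [Set.uIcc_of_le hab] at hy
      have : y ≠ 0 := (ha.trans_le hy.1).ne'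
      convert! (hasDerivAt_inv this).neg using 1
      ring
  · exact ((intervalIntegrable_iff_integrableOn_Ioc_of_le hab).1 hi).mono_set Set.Ioo_subset_Ioc_self
  · exact Filter.Eventually.of_forall fun y => by positivity

lemma outer_int (Y R C : ℝ) (hY : 0 < Y) (hR : 0 < R) (hC : 0 < C) (h : C ^ 2 = Y ^ 2 + R ^ 2) :
    ∫ x in (-R)..R, 2 * √(R ^ 2 - x ^ 2) / (Y ^ 2 + x ^ 2) = 2 * Real.pi * (C / Y - 1) := by
  have hpos : ∀ x : ℝ, 0 < x ^ 2 + Y ^ 2 := fun x => by positivity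
  have hsne : ∀ x : ℝ, R * √(x ^ 2 + Y ^ 2) ≠ 0 := fun x =>
    (mul_pos hR (Real.sqrt_pos.2 (hpos x))).ne'
  rw [intervalIntegral.integral_eq_sub_of_hasDerivAt_of_le (by linarith)
    (f := fun x => 2 * (- Real.arcsin (x / R) +
      (C / Y) * Real.arcsin (C * x / (R * √(x ^ 2 + Y ^ 2)))))]
  · have e1 : √(R ^ 2 + Y ^ 2) = C := by
      rw [add_comm, ← h, Real.sqrt_sq hC.le]
    have e2 : C * R / (R * C) = 1 := by field_simp
    have e3 : C * -R / (R * C) = -1 := by field_simp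
    have e4 : -R / R = -1 := by field_simp
    simp only [neg_sq, e1, e2, e3, e4, div_self hR.ne', Real.arcsin_one, Real.arcsin_neg_one]
    ring
  · apply Continuous.continuousOn
    have : Continuous fun x : ℝ => C * x / (R * √(x ^ 2 + Y ^ 2)) :=
      Continuous.div (by fun_prop) (by fun_prop) hsne
    have := Real.continuous_arcsin.comp this
    have := Real.continuous_arcsin.comp (continuous_id.div_const R)
    simp only [Function.comp_def, id] at *
    fun_prop
  · intro x hx
    have hx2 : 0 < R ^ 2 - x ^ 2 := by nlinarith [hx.1, hx.2]
    set S := √(x ^ 2 + Y ^ 2) with hS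
    set T := √(R ^ 2 - x ^ 2) with hT
    have hS2 : S ^ 2 = x ^ 2 + Y ^ 2 := Real.sq_sqrt (hpos x).le
    have hT2 : T ^ 2 = R ^ 2 - x ^ 2 := Real.sq_sqrt hx2.le
    have hS0 : 0 < S := Real.sqrt_pos.2 (hpos x)
    have hT0 : 0 < T := Real.sqrt_pos.2 hx2
    have k1 : 1 - (x / R) ^ 2 = (T / R) ^ 2 := by
      field_simp; linarith
    have k2 : 1 - (C * x / (R * S)) ^ 2 = (Y * T / (R * S)) ^ 2 := by
      field_simp; rw [hT2, hS2, h]; ring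
    have n1 : (0:ℝ) < (T / R) ^ 2 := by positivity
    have n2 : (0:ℝ) < (Y * T / (R * S)) ^ 2 := by positivity
    have d0 : HasDerivAt (fun x : ℝ => √(x ^ 2 + Y ^ 2)) (x / S) x := by
      have := ((hasDerivAt_pow 2 x).add_const (Y ^ 2)).sqrt (hpos x).ne'
      convert! this using 1
      rw [← hS]; field_simp; norm_num [mul_comm]
    have d1 : HasDerivAt (fun x : ℝ => C * x / (R * √(x ^ 2 + Y ^ 2)))
        (C * Y ^ 2 / (R * S ^ 3)) x := by
      have := ((hasDerivAt_id x).const_mul C).div (d0.const_mul R) (hsne x)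
      convert! this using 1
      simp only [id, ← hS]
      field_simp
      rw [hS2]; ring
    have a1 := (Real.hasDerivAt_arcsin (x := x / R)
      (by intro e; rw [e] at k1; norm_num at k1; linarith [k1, n1])
      (by intro e; rw [e] at k1; norm_num at k1; linarith [k1, n1])).comp x
      ((hasDerivAt_id x).div_const R)
    have a2 := (Real.hasDerivAt_arcsin (x := C * x / (R * S))
      (by intro e; rw [e] at k2; linarith)
      (by intro e; rw [e] at k2; linarith)).comp x d1
    have := (a1.neg.add (a2.const_mul (C / Y))).const_mul 2
    convert! this using 1
    rw [k1, k2, Real.sqrt_sq (by positivity), Real.sqrt_sq (by positivity), add_comm (Y ^ 2), ← hS2]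
    field_simp
    rw [hT2, hS2, h]; ring
  · apply Continuous.intervalIntegrable
    exact Continuous.div (by fun_prop) (by fun_prop) (fun x => by positivity)

lemma hyp_eq (s : Set UpperHalfPlane) (hs : MeasurableSet s) :
    hypMeasure s = ∫⁻ z : ℂ in (fun z : UpperHalfPlane => (z : ℂ)) '' s,
      ENNReal.ofReal (1 / z.im ^ 2) := by
  have hm : MeasurableEmbedding (fun z : UpperHalfPlane => (z : ℂ)) :=
    UpperHalfPlane.isOpenEmbedding_coe.measurableEmbedding
  rw [hypMeasure, withDensity_apply _ hs,
    ← Set.inter_eq_self_of_subset_left (Set.image_subset_range _ s),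
    ← Measure.restrict_restrict (hm.measurableSet_image.2 hs), ← hm.map_comap,
    hm.restrict_map, hm.lintegral_map, hm.injective.preimage_image]
  rfl

lemma ball_int (a C R Y : ℝ) (hY : 0 < Y) (hR : 0 < R) (hC : 0 < C) (h : C ^ 2 = Y ^ 2 + R ^ 2) :
    ∫⁻ z : ℂ in Metric.ball (⟨a, C⟩ : ℂ) R, ENNReal.ofReal (1 / z.im ^ 2) =
      ENNReal.ofReal (2 * Real.pi * (C / Y - 1)) := by
  have hRC : R < C := by nlinarith [sq_nonneg (R - C), sq_pos_of_pos hY]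
  rw [← lintegral_indicator Metric.isOpen_ball.measurableSet,
    ← Complex.volume_preserving_equiv_real_prod.symm.lintegral_comp_emb
      (Complex.measurableEquivRealProd.symm.measurableEmbedding)]
  rw [Measure.volume_eq_prod, lintegral_prod]
  swap
  · apply Measurable.aemeasurable
    refine Measurable.comp (Measurable.indicator ?_ Metric.isOpen_ball.measurableSet)
      Complex.measurableEquivRealProd.symm.measurable
    fun_prop
  have key : ∀ x : ℝ, ∫⁻ y : ℝ, (Metric.ball (⟨a, C⟩ : ℂ) R).indicator
      (fun z : ℂ => ENNReal.ofReal (1 / z.im ^ 2)) (Complex.measurableEquivRealProd.symm (x, y))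
      = (Set.Ioc (a - R) (a + R)).indicator (fun x => ENNReal.ofReal
        (2 * √(R ^ 2 - (x - a) ^ 2) / (Y ^ 2 + (x - a) ^ 2))) x := by
    intro x
    set T := √(R ^ 2 - (x - a) ^ 2) with hT
    have hTR : T ≤ R := by
      rw [hT]; apply Real.sqrt_le_iff.2 ⟨hR.le, by nlinarith [sq_nonneg (x - a)]⟩
    have hT0 : 0 ≤ T := Real.sqrt_nonneg _
    have e : ∀ y : ℝ, (Metric.ball (⟨a, C⟩ : ℂ) R).indicator
      (fun z : ℂ => ENNReal.ofReal (1 / z.im ^ 2)) (Complex.measurableEquivRealProd.symm (x, y))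
      = (Set.Ioo (C - T) (C + T)).indicator (fun y => ENNReal.ofReal (1 / y ^ 2)) y := by
      intro y
      have : (Complex.measurableEquivRealProd.symm (x, y)) = (⟨x, y⟩ : ℂ) := rfl
      rw [this]
      have iff : (⟨x, y⟩ : ℂ) ∈ Metric.ball (⟨a, C⟩ : ℂ) R ↔ y ∈ Set.Ioo (C - T) (C + T) := by
        rw [Metric.mem_ball, Complex.dist_mk, Real.sqrt_lt' hR]
        have : y ∈ Set.Ioo (C - T) (C + T) ↔ |y - C| < T := by
          rw [abs_lt, Set.mem_Ioo]; constructor <;> rintro ⟨h1, h2⟩ <;> constructor <;> linarith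
        rw [this, hT, Real.lt_sqrt (abs_nonneg _), sq_abs]
        constructor <;> intro <;> linarith
      by_cases hy : y ∈ Set.Ioo (C - T) (C + T)
      · rw [Set.indicator_of_mem hy, Set.indicator_of_mem (iff.2 hy)]
      · rw [Set.indicator_of_notMem hy, Set.indicator_of_notMem (mt iff.1 hy)]
    simp_rw [e]
    rw [lintegral_indicator measurableSet_Ioo, inner_int _ _ (by linarith) (by linarith)]
    have f1 : C - T ≠ 0 := by linarith
    have f2 : C + T ≠ 0 := by linarith
    have f3 : Y ^ 2 + (x - a) ^ 2 ≠ 0 := by positivity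
    by_cases hx : x ∈ Set.Ioc (a - R) (a + R)
    · rw [Set.indicator_of_mem hx]
      have hT2 : T ^ 2 = R ^ 2 - (x - a) ^ 2 := Real.sq_sqrt (by nlinarith [hx.1, hx.2])
      have : Y ^ 2 + (x - a) ^ 2 = (C - T) * (C + T) := by linarith
      rw [← hT, this]
      congr 1
      field_simp; ring
    · rw [Set.indicator_of_notMem hx]
      have : T = 0 := by
        apply Real.sqrt_eq_zero_of_nonpos
        simp only [Set.mem_Ioc, not_and_or, not_lt, not_le] at hx
        rcases hx with hx | hx <;> nlinarith
      simp [this]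
  simp_rw [key]
  rw [lintegral_indicator measurableSet_Ioc]
  have hle : a - R ≤ a + R := by linarith
  have hcont : Continuous fun x : ℝ => 2 * √(R ^ 2 - (x - a) ^ 2) / (Y ^ 2 + (x - a) ^ 2) :=
    Continuous.div (by fun_prop) (by fun_prop) (fun x => by positivity)
  rw [← ofReal_integral_eq_lintegral_ofReal]
  · rw [← intervalIntegral.integral_of_le hle,
      intervalIntegral.integral_comp_sub_right
        (fun x => 2 * √(R ^ 2 - x ^ 2) / (Y ^ 2 + x ^ 2)) a,
      ← outer_int Y R C hY hR hC h]
    congr 2 <;> ring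
  · exact (intervalIntegrable_iff_integrableOn_Ioc_of_le hle).1 (hcont.intervalIntegrable _ _)
  · exact Filter.Eventually.of_forall fun y => by positivity

/-- The hyperbolic area of a hyperbolic ball of radius `r ≥ 0` in the upper half-plane
is `2π(cosh r − 1)`. -/
theorem stmt_0 (z : UpperHalfPlane) (r : ℝ) (hr : 0 ≤ r) :
    hypMeasure (Metric.ball z r) = ENNReal.ofReal (2 * Real.pi * (Real.cosh r - 1)) := by
  rcases hr.eq_or_lt with rfl | hr
  · simp
  have hY := z.im_pos
  rw [hyp_eq _ Metric.isOpen_ball.measurableSet]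
  have hb := UpperHalfPlane.image_coe_ball z r
  have hc : ((z.center r : UpperHalfPlane) : ℂ) = ⟨z.re, z.im * Real.cosh r⟩ := rfl
  rw [hb, hc, ball_int _ _ _ z.im hY (mul_pos hY (Real.sinh_pos_iff.2 hr))
    (mul_pos hY (Real.cosh_pos r))
    (by rw [mul_pow, mul_pow, Real.cosh_sq]; ring)]
  rw [mul_div_cancel_left₀ _ hY.ne']
end

section
/- Let ℓ > 0, h > 0, t ∈ ℝ and y ∈ ℝ/ℓℤ. The measure, with respect to the measure e^{-t'} dt' dy' on ℝ × (ℝ/ℓℤ), of the set { (t', y') : (e^{t'} − e^{t} cosh h)² + d_{ℝ/ℓℤ}(y, y')² ≤ e^{2t} sinh² h } equals ∫_{-m}^{m} (2 √(sinh² h − z²))/(1 + z²) dz, where m = min(e^{-t} ℓ/2, sinh h). -/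
open MeasureTheory Real

lemma aux_fibre (A B w : ℝ) (hA : 0 < A) (hB : 0 ≤ B) (hBA : B < A ^ 2) (hw : 0 ≤ w) :
    (volume.withDensity fun t' : ℝ => ENNReal.ofReal (Real.exp (-t')))
      {x : ℝ | (Real.exp x - A) ^ 2 + w ≤ B}
    = ENNReal.ofReal (2 * Real.sqrt (B - w) / (A ^ 2 - B + w)) := by
  rcases lt_or_ge B w with hlt | hge
  · have h1 : {x : ℝ | (Real.exp x - A) ^ 2 + w ≤ B} = ∅ := by
      ext x
      simp only [Set.mem_setOf_eq, Set.mem_empty_iff_false, iff_false, not_le]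
      nlinarith [sq_nonneg (Real.exp x - A)]
    rw [h1, Real.sqrt_eq_zero_of_nonpos (by linarith)]
    simp
  · set r := Real.sqrt (B - w) with hr
    have hr0 : 0 ≤ r := Real.sqrt_nonneg _
    have hr2 : r ^ 2 = B - w := Real.sq_sqrt (by linarith)
    have hrA : r < A := by nlinarith
    have h1 : {x : ℝ | (Real.exp x - A) ^ 2 + w ≤ B}
        = Set.Icc (Real.log (A - r)) (Real.log (A + r)) := by
      ext x
      simp only [Set.mem_setOf_eq, Set.mem_Icc]
      rw [Real.log_le_iff_le_exp (by linarith), Real.le_log_iff_exp_le (by linarith)]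
      have : (Real.exp x - A) ^ 2 + w ≤ B ↔ (Real.exp x - A) ^ 2 ≤ r ^ 2 := by
        rw [hr2]; constructor <;> intro h <;> linarith
      rw [this, sq_le_sq, abs_of_nonneg hr0, abs_le]
      constructor <;> rintro ⟨h1, h2⟩ <;> constructor <;> linarith
    have hle : Real.log (A - r) ≤ Real.log (A + r) :=
      Real.log_le_log (by linarith) (by linarith)
    rw [h1, withDensity_apply _ measurableSet_Icc, ← restrict_Ioc_eq_restrict_Icc,
      ← ofReal_integral_eq_lintegral_ofReal, ← intervalIntegral.integral_of_le hle]
    · have h3 : ∫ x in (Real.log (A - r))..(Real.log (A + r)), Real.exp (-x)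
          = (A - r)⁻¹ - (A + r)⁻¹ := by
        rw [intervalIntegral.integral_comp_neg (fun x => Real.exp x), integral_exp,
          Real.exp_neg, Real.exp_neg, Real.exp_log (by linarith), Real.exp_log (by linarith)]
      rw [h3]
      congr 1
      have h4 : A ^ 2 - B + w = (A - r) * (A + r) := by nlinarith
      have h5 : A - r ≠ 0 := by linarith
      have h6 : A + r ≠ 0 := by linarith
      rw [h4]
      field_simp
      ring
    · exact (Continuous.integrableOn_Icc (by fun_prop)).mono_set Set.Ioc_subset_Icc_self
    · exact Filter.Eventually.of_forall fun x => (Real.exp_pos _).le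

lemma aux_circle (ℓ : ℝ) [hℓ : Fact (0 < ℓ)] (y : AddCircle ℓ) (g : ℝ → ℝ) (hg : Continuous g)
    (hg0 : ∀ x, 0 ≤ g x) :
    ∫⁻ u : AddCircle ℓ, ENNReal.ofReal (g (dist y u ^ 2))
      = ENNReal.ofReal (∫ a in (-(ℓ / 2))..(ℓ / 2), g (a ^ 2)) := by
  have hl : 0 < ℓ := hℓ.out
  simp_rw [dist_eq_norm]
  rw [lintegral_sub_left_eq_self (fun u : AddCircle ℓ => ENNReal.ofReal (g (‖u‖ ^ 2))) y,
    ← AddCircle.lintegral_preimage ℓ (-(ℓ / 2)), intervalIntegral.integral_of_le (by linarith),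
    ofReal_integral_eq_lintegral_ofReal]
  · have : -(ℓ / 2) + ℓ = ℓ / 2 := by ring
    rw [this]
    refine setLIntegral_congr_fun measurableSet_Ioc fun a ha => ?_
    have : ‖(a : AddCircle ℓ)‖ = |a| := by
      rw [AddCircle.norm_coe_eq_abs_iff ℓ hl.ne', abs_of_pos hl, abs_le]
      exact ⟨ha.1.le, ha.2⟩
    simp only [this, sq_abs]
  · exact (Continuous.integrableOn_Icc (by fun_prop)).mono_set Set.Ioc_subset_Icc_self
  · exact Filter.Eventually.of_forall fun x => hg0 _

lemma aux_cut (M s : ℝ) (hM : 0 < M) (hs : 0 < s) :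
    ∫ z in (-M)..M, 2 * Real.sqrt (s ^ 2 - z ^ 2) / (1 + z ^ 2)
    = ∫ z in (-(min M s))..(min M s), 2 * Real.sqrt (s ^ 2 - z ^ 2) / (1 + z ^ 2) := by
  rcases le_total M s with h | h
  · rw [min_eq_left h]
  · rw [min_eq_right h]
    have hc : Continuous fun z : ℝ => 2 * Real.sqrt (s ^ 2 - z ^ 2) / (1 + z ^ 2) := by
      refine Continuous.div (by fun_prop) (by fun_prop) fun z => by positivity
    have hi := fun a b => hc.intervalIntegrable (μ := volume) a b
    rw [← intervalIntegral.integral_add_adjacent_intervals (hi (-M) (-s)) (hi (-s) M),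
      ← intervalIntegral.integral_add_adjacent_intervals (hi (-s) s) (hi s M)]
    have h0 : ∀ z : ℝ, s ^ 2 ≤ z ^ 2 → 2 * Real.sqrt (s ^ 2 - z ^ 2) / (1 + z ^ 2) = 0 := by
      intro z hz
      rw [Real.sqrt_eq_zero_of_nonpos (by linarith)]; simp
    have e1 : ∫ z in (-M)..(-s), 2 * Real.sqrt (s ^ 2 - z ^ 2) / (1 + z ^ 2) = 0 := by
      rw [intervalIntegral.integral_congr (g := fun _ => (0 : ℝ))]
      · simp
      · intro z hz
        rw [Set.uIcc_of_le (by linarith)] at hz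
        exact h0 z (by nlinarith [hz.1, hz.2])
    have e2 : ∫ z in s..M, 2 * Real.sqrt (s ^ 2 - z ^ 2) / (1 + z ^ 2) = 0 := by
      rw [intervalIntegral.integral_congr (g := fun _ => (0 : ℝ))]
      · simp
      · intro z hz
        rw [Set.uIcc_of_le (by linarith)] at hz
        exact h0 z (by nlinarith [hz.1, hz.2])
    rw [e1, e2]; ring

/-- The volume (with respect to the measure `e^{-t'} dt' dy'` on `ℝ × ℝ/ℓℤ`) of the
geodesic ball of radius `h` centered at `(t, y)` in the hyperbolic cusp, written in the
coordinate `x' = e^{t'}`, equals `∫_{-m}^{m} 2√(sinh²h − z²)/(1+z²) dz` where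
`m = min(e^{-t} ℓ/2, sinh h)`. -/
theorem stmt_1 (ℓ : ℝ) [Fact (0 < ℓ)] (h : ℝ) (hh : 0 < h) (t : ℝ) (y : AddCircle ℓ) :
    ((volume.withDensity fun t' : ℝ => ENNReal.ofReal (Real.exp (-t'))).prod
        (volume : Measure (AddCircle ℓ)))
      {p : ℝ × AddCircle ℓ |
        (Real.exp p.1 - Real.exp t * Real.cosh h) ^ 2 + dist y p.2 ^ 2
          ≤ Real.exp (2 * t) * Real.sinh h ^ 2}
    = ENNReal.ofReal (∫ z in (-(min (Real.exp (-t) * ℓ / 2) (Real.sinh h)))..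
        (min (Real.exp (-t) * ℓ / 2) (Real.sinh h)),
        2 * Real.sqrt (Real.sinh h ^ 2 - z ^ 2) / (1 + z ^ 2)) := by
  have hl : 0 < ℓ := Fact.out
  have hs : 0 < Real.sinh h := Real.sinh_pos_iff.2 hh
  have hE : Real.exp (2 * t) = Real.exp t ^ 2 := by rw [← Real.exp_nat_mul]; norm_num
  have het := Real.exp_pos t
  have hcs := Real.cosh_sq h
  have hmeas : MeasurableSet {p : ℝ × AddCircle ℓ |
        (Real.exp p.1 - Real.exp t * Real.cosh h) ^ 2 + dist y p.2 ^ 2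
          ≤ Real.exp (2 * t) * Real.sinh h ^ 2} :=
    (isClosed_le (by fun_prop) (by fun_prop)).measurableSet
  have hsub : (Real.exp t * Real.cosh h) ^ 2 - Real.exp (2 * t) * Real.sinh h ^ 2
      = Real.exp t ^ 2 := by
    rw [hE, mul_pow, hcs]; ring
  have hfib : ∀ u : AddCircle ℓ, (volume.withDensity fun t' : ℝ => ENNReal.ofReal (Real.exp (-t')))
      ((fun x => (x, u)) ⁻¹' {p : ℝ × AddCircle ℓ |
        (Real.exp p.1 - Real.exp t * Real.cosh h) ^ 2 + dist y p.2 ^ 2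
          ≤ Real.exp (2 * t) * Real.sinh h ^ 2})
      = ENNReal.ofReal ((fun w : ℝ => 2 * Real.sqrt (Real.exp (2 * t) * Real.sinh h ^ 2 - w)
          / (Real.exp t ^ 2 + |w|)) (dist y u ^ 2)) := by
    intro u
    have := aux_fibre (Real.exp t * Real.cosh h) (Real.exp (2 * t) * Real.sinh h ^ 2)
      (dist y u ^ 2) (mul_pos het (Real.cosh_pos h)) (by positivity)
      (by nlinarith [pow_pos het 2]) (by positivity)
    rw [hsub] at this
    simp only [abs_of_nonneg (sq_nonneg (dist y u))]
    exact this
  rw [Measure.prod_apply_symm hmeas, lintegral_congr hfib,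
    aux_circle ℓ y (fun w : ℝ => 2 * Real.sqrt (Real.exp (2 * t) * Real.sinh h ^ 2 - w)
          / (Real.exp t ^ 2 + |w|)), ← aux_cut _ _ (by positivity) hs]
  · congr 1
    have key := intervalIntegral.mul_integral_comp_mul_left (a := -(Real.exp (-t) * ℓ / 2))
      (b := Real.exp (-t) * ℓ / 2)
      (f := fun a : ℝ => 2 * Real.sqrt (Real.exp (2 * t) * Real.sinh h ^ 2 - a ^ 2)
          / (Real.exp t ^ 2 + |a ^ 2|)) (c := Real.exp t)
    have hb : Real.exp t * (Real.exp (-t) * ℓ / 2) = ℓ / 2 := by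
      rw [Real.exp_neg]; field_simp
    rw [mul_neg, hb] at key
    rw [← key, ← intervalIntegral.integral_const_mul]
    refine intervalIntegral.integral_congr fun z _ => ?_
    have e1 : Real.exp (2 * t) * Real.sinh h ^ 2 - (Real.exp t * z) ^ 2
        = Real.exp t ^ 2 * (Real.sinh h ^ 2 - z ^ 2) := by rw [hE]; ring
    rw [e1, Real.sqrt_mul (by positivity), Real.sqrt_sq het.le, abs_of_nonneg (sq_nonneg _)]
    have : Real.exp t ^ 2 + (Real.exp t * z) ^ 2 = Real.exp t ^ 2 * (1 + z ^ 2) := by ring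
    rw [this]
    have : 1 + z ^ 2 ≠ 0 := by positivity
    field_simp
  · exact Continuous.div (by fun_prop) (by fun_prop) fun z => by positivity
  · intro x; positivity
end

section
/- There exist C > 0 and h₀ > 0 such that for all h ∈ (0, h₀] and all a with 0 < a ≤ sinh h, one has | ∫_{-a}^{a} (2 √(sinh² h − z²))/(1 + z²) dz − 4 a sinh h | ≤ C a³ / sinh h. -/
open Real intervalIntegral

/-- Volume asymptotics of the overlapping geodesic ball in the cusp:
`∫_{-a}^{a} 2√(sinh²h − z²)/(1+z²) dz = 4 a sinh h + O(a³ / sinh h)`. -/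
theorem stmt_2 :
    ∃ C > (0 : ℝ), ∃ h₀ > (0 : ℝ), ∀ h ∈ Set.Ioc (0 : ℝ) h₀, ∀ a : ℝ,
      0 < a → a ≤ Real.sinh h →
        |(∫ z in (-a)..a, 2 * Real.sqrt (Real.sinh h ^ 2 - z ^ 2) / (1 + z ^ 2))
          - 4 * a * Real.sinh h| ≤ C * a ^ 3 / Real.sinh h := by
  refine ⟨8, by norm_num, Real.arsinh 1, Real.arsinh_pos_iff.2 one_pos, ?_⟩
  rintro h ⟨h0, h1⟩ a ha has
  have hs1 : Real.sinh h ≤ 1 := by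
    have := Real.sinh_le_sinh.2 h1
    rwa [Real.sinh_arsinh] at this
  have hs0 : 0 < Real.sinh h := Real.sinh_pos_iff.2 h0
  generalize Real.sinh h = s at *
  have hc : Continuous fun z : ℝ => 2 * Real.sqrt (s ^ 2 - z ^ 2) / (1 + z ^ 2) := by
    refine Continuous.div (by fun_prop) (by fun_prop) ?_
    intro z
    positivity
  have hI : (∫ z in (-a)..a, 2 * Real.sqrt (s ^ 2 - z ^ 2) / (1 + z ^ 2)) - 4 * a * s
      = ∫ z in (-a)..a, (2 * Real.sqrt (s ^ 2 - z ^ 2) / (1 + z ^ 2) - 2 * s) := by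
    rw [intervalIntegral.integral_sub (hc.intervalIntegrable _ _) (by simp),
      intervalIntegral.integral_const, smul_eq_mul]
    ring
  rw [hI]
  have key := intervalIntegral.norm_integral_le_of_norm_le_const (a := -a) (b := a)
    (f := fun z : ℝ => 2 * Real.sqrt (s ^ 2 - z ^ 2) / (1 + z ^ 2) - 2 * s)
    (C := 4 * a ^ 2 / s) (by
      intro z hz
      rw [Set.uIoc_of_le (by linarith)] at hz
      have hza : z ^ 2 ≤ a ^ 2 := sq_le_sq' hz.1.le hz.2
      have has2 : a ^ 2 ≤ s ^ 2 := by gcongr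
      have hr0 := Real.sqrt_nonneg (s ^ 2 - z ^ 2)
      have hr2 := Real.sq_sqrt (show 0 ≤ s ^ 2 - z ^ 2 by linarith)
      generalize Real.sqrt (s ^ 2 - z ^ 2) = r at *
      have hz0 := sq_nonneg z
      have hrs : r ≤ s := by nlinarith
      have hp : 0 < 1 + z ^ 2 := by positivity
      have e : 2 * r / (1 + z ^ 2) - 2 * s = -((2 * s * (1 + z ^ 2) - 2 * r) / (1 + z ^ 2)) := by
        field_simp
        ring
      have hsz : 0 ≤ s * z ^ 2 := by positivity
      have hn : 0 ≤ 2 * s * (1 + z ^ 2) - 2 * r := by nlinarith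
      rw [Real.norm_eq_abs, e, abs_neg, abs_of_nonneg (by positivity), div_le_div_iff₀ hp hs0]
      have b1 : s * (s - r) ≤ z ^ 2 := by nlinarith [mul_nonneg hr0 (sub_nonneg.2 hrs)]
      have b2 : s ^ 2 * z ^ 2 ≤ z ^ 2 := by
        have : s ^ 2 ≤ 1 := by nlinarith
        nlinarith
      have b3 : 0 ≤ a ^ 2 * z ^ 2 := by positivity
      nlinarith)
  rw [Real.norm_eq_abs] at key
  refine key.trans (le_of_eq ?_)
  rw [abs_of_nonneg (by linarith)]
  ring
end

section
/- There exist c > 0 and h₀ > 0 such that for all h ∈ (0, h₀] and all a with 0 < a ≤ sinh h, one has ∫_{-a}^{a} (2 √(sinh² h − z²))/(1 + z²) dz ≥ c a h. -/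
open Real intervalIntegral

/-- Lower bound on the volume of the overlapping geodesic ball in the cusp:
`∫_{-a}^{a} 2√(sinh²h − z²)/(1+z²) dz ≥ c a h`. -/
theorem stmt_3 :
    ∃ c > (0 : ℝ), ∃ h₀ > (0 : ℝ), ∀ h ∈ Set.Ioc (0 : ℝ) h₀, ∀ a : ℝ,
      0 < a → a ≤ Real.sinh h →
        c * a * h ≤ ∫ z in (-a)..a, 2 * Real.sqrt (Real.sinh h ^ 2 - z ^ 2) / (1 + z ^ 2) := by
  refine ⟨1, one_pos, Real.arsinh 1, Real.arsinh_pos_iff.2 one_pos, ?_⟩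
  rintro h ⟨h0, h1⟩ a ha has
  have hs1 : Real.sinh h ≤ 1 := by
    have := Real.sinh_le_sinh.2 h1
    rwa [Real.sinh_arsinh] at this
  have hsh : h ≤ Real.sinh h := Real.self_le_sinh_iff.2 h0.le
  generalize Real.sinh h = s at *
  have hs : 0 < s := by linarith
  have key : ∫ z in (-a)..a, (s - s⁻¹ * z ^ 2) ≤
      ∫ z in (-a)..a, 2 * Real.sqrt (s ^ 2 - z ^ 2) / (1 + z ^ 2) := by
    apply intervalIntegral.integral_mono_on (by linarith)
    · exact Continuous.intervalIntegrable (by fun_prop) _ _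
    · apply Continuous.intervalIntegrable
      exact Continuous.div (by fun_prop) (by fun_prop) (fun x => by positivity)
    · rintro z ⟨hz1, hz2⟩
      have hz : z ^ 2 ≤ s ^ 2 := by nlinarith
      have hq0 := Real.sqrt_nonneg (s ^ 2 - z ^ 2)
      have hq := Real.sq_sqrt (sub_nonneg.2 hz)
      have hqs : Real.sqrt (s ^ 2 - z ^ 2) ≤ s := by
        apply Real.sqrt_le_iff.2 ⟨hs.le, by nlinarith⟩
      have e : s - s⁻¹ * z ^ 2 = (s ^ 2 - z ^ 2) / s := by field_simp
      have h2 : (s ^ 2 - z ^ 2) / s ≤ Real.sqrt (s ^ 2 - z ^ 2) := by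
        rw [div_le_iff₀ hs]; nlinarith
      rw [e]
      refine h2.trans ?_
      rw [le_div_iff₀ (by positivity)]
      have hz3 : z ^ 2 ≤ 1 := by nlinarith
      nlinarith [mul_nonneg hq0 (sub_nonneg.2 hz3)]
  refine le_trans ?_ key
  rw [intervalIntegral.integral_sub (by simp)
    (Continuous.intervalIntegrable (by fun_prop) _ _), intervalIntegral.integral_const_mul,
    integral_pow, intervalIntegral.integral_const]
  have h3 : s⁻¹ * a ^ 2 ≤ s := by
    rw [inv_mul_le_iff₀ hs]; nlinarith
  have h4 : a * (s⁻¹ * a ^ 2) ≤ a * s := by gcongr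
  have h5 : a * h ≤ a * s := by gcongr
  norm_num
  nlinarith [mul_pos ha hs]
end

section
/- For every h > 0, the linear map A_h on L²(ℝ, ℂ) defined by (A_h u)(t) = (1/(2 sinh h)) ∫_{t-h}^{t+h} u(s) ds is a bounded operator, and its operator norm equals h / sinh h. -/
open MeasureTheory Real

/-- Cauchy–Schwarz against the constant one. -/
lemma avg_cs {α : Type*} [MeasurableSpace α] (μ : Measure α) (f : α → ENNReal)
    (hf : AEMeasurable f μ) :
    (∫⁻ x, f x ∂μ) ^ 2 ≤ μ Set.univ * ∫⁻ x, f x ^ 2 ∂μ := by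
  have H := ENNReal.lintegral_mul_le_Lp_mul_Lq μ Real.HolderConjugate.two_two
    (f := fun _ => 1) (g := f) aemeasurable_const hf
  simp only [Pi.mul_apply, one_mul, lintegral_const, ENNReal.rpow_two] at H
  have hs : ∀ a : ENNReal, (a ^ (1 / 2 : ℝ)) ^ 2 = a := by
    intro a
    rw [← ENNReal.rpow_two, ← ENNReal.rpow_mul]
    norm_num
  calc _ ≤ _ := pow_le_pow_left' H 2
    _ = _ := by rw [mul_pow, hs, hs, one_pow, one_mul]

/-- The unnormalised window integral. -/
noncomputable def avgF (h : ℝ) (u : ℝ → ℂ) (t : ℝ) : ℂ := ∫ s in (t - h)..(t + h), u s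

lemma avgF_eq (h : ℝ) (hh : 0 < h) (u : ℝ → ℂ) (t : ℝ) :
    avgF h u t = ∫ r in Set.Ioc (-h) h, u (t + r) := by
  rw [avgF, ← intervalIntegral.integral_of_le (by linarith),
    intervalIntegral.integral_comp_add_left (fun x => u x), sub_eq_add_neg]

lemma avgF_meas (h : ℝ) (hh : 0 < h) (u : ℝ → ℂ) (hu : StronglyMeasurable u) :
    StronglyMeasurable (avgF h u) := by
  have : avgF h u = fun t => ∫ r in Set.Ioc (-h) h, u (t + r) := by
    ext t; exact avgF_eq h hh u t
  rw [this]
  have h2 : StronglyMeasurable (fun p : ℝ × ℝ => u (p.1 + p.2)) :=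
    hu.comp_measurable (measurable_fst.add measurable_snd)
  exact h2.integral_prod_right'

lemma avgF_sq (h : ℝ) (hh : 0 < h) (u : ℝ → ℂ) (hu : StronglyMeasurable u) :
    ∫⁻ t, ‖avgF h u t‖ₑ ^ 2 ≤ ENNReal.ofReal (2 * h) ^ 2 * ∫⁻ t, ‖u t‖ₑ ^ 2 := by
  have hm : Measurable (fun p : ℝ × ℝ => ‖u (p.1 + p.2)‖ₑ ^ 2) :=
    ((hu.comp_measurable (measurable_fst.add measurable_snd)).enorm).pow_const 2
  have hv : (volume.restrict (Set.Ioc (-h) h)) Set.univ = ENNReal.ofReal (2 * h) := by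
    rw [Measure.restrict_apply_univ, Real.volume_Ioc]; congr 1; ring
  calc ∫⁻ t, ‖avgF h u t‖ₑ ^ 2
      ≤ ∫⁻ t, ENNReal.ofReal (2 * h) * ∫⁻ r in Set.Ioc (-h) h, ‖u (t + r)‖ₑ ^ 2 := by
        refine lintegral_mono fun t => ?_
        rw [avgF_eq h hh, ← hv]
        refine (pow_le_pow_left' (enorm_integral_le_lintegral_enorm _) 2).trans ?_
        refine avg_cs _ _ ?_
        exact ((hu.comp_measurable (measurable_const_add t)).enorm).aemeasurable
    _ = ENNReal.ofReal (2 * h) * ∫⁻ t, ∫⁻ r in Set.Ioc (-h) h, ‖u (t + r)‖ₑ ^ 2 := by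
        rw [lintegral_const_mul' _ _ ENNReal.ofReal_ne_top]
    _ = ENNReal.ofReal (2 * h) * ∫⁻ r in Set.Ioc (-h) h, ∫⁻ t, ‖u (t + r)‖ₑ ^ 2 := by
        rw [lintegral_lintegral_swap]
        exact hm.aemeasurable
    _ = _ := by
        have : ∀ r, ∫⁻ t, ‖u (t + r)‖ₑ ^ 2 = ∫⁻ t, ‖u t‖ₑ ^ 2 := fun r =>
          lintegral_add_right_eq_self (fun t => ‖u t‖ₑ ^ 2) r
        simp_rw [this]
        rw [lintegral_const, hv]
        ring

lemma avgF_eLpNorm (h : ℝ) (hh : 0 < h) (u : ℝ → ℂ) (hu : StronglyMeasurable u) :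
    eLpNorm (avgF h u) 2 volume ≤ ENNReal.ofReal (2 * h) * eLpNorm u 2 volume := by
  have e : ∀ f : ℝ → ℂ, eLpNorm f 2 volume ^ 2 = ∫⁻ t, ‖f t‖ₑ ^ 2 := by
    intro f
    have := eLpNorm_nnreal_pow_eq_lintegral (μ := (volume : Measure ℝ)) (f := f) (p := 2) (by norm_num)
    simpa using this
  have := avgF_sq h hh u hu
  rw [← e, ← e, ← mul_pow] at this
  exact (ENNReal.pow_le_pow_left_iff (by norm_num)).1 this

lemma avg_ii (u : Lp ℂ 2 (volume : Measure ℝ)) (a b : ℝ) :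
    IntervalIntegrable u volume a b := by
  have := (Lp.memLp u).locallyIntegrable (by norm_num)
  exact (this.integrableOn_isCompact isCompact_uIcc).intervalIntegrable

lemma avgF_memLp (h : ℝ) (hh : 0 < h) (u : Lp ℂ 2 (volume : Measure ℝ)) (c : ℂ) :
    MemLp (fun t => c * avgF h u t) 2 volume := by
  refine MemLp.const_mul ⟨(avgF_meas h hh u (Lp.stronglyMeasurable u)).aestronglyMeasurable, ?_⟩ c
  refine (avgF_eLpNorm h hh u (Lp.stronglyMeasurable u)).trans_lt ?_
  exact ENNReal.mul_lt_top ENNReal.ofReal_lt_top (Lp.memLp u).2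

lemma avgF_congr (h : ℝ) (u v : ℝ → ℂ) (huv : u =ᵐ[volume] v) (t : ℝ) :
    avgF h u t = avgF h v t := by
  refine intervalIntegral.integral_congr_ae ?_
  filter_upwards [huv] with x hx _ using hx

/-- The operator as a linear map. -/
noncomputable def avgL (h : ℝ) (hh : 0 < h) (c : ℂ) :
    Lp ℂ 2 (volume : Measure ℝ) →ₗ[ℂ] Lp ℂ 2 (volume : Measure ℝ) where
  toFun u := (avgF_memLp h hh u c).toLp _
  map_add' u v := by
    rw [← MemLp.toLp_add]
    congr 1
    ext t
    simp only [Pi.add_apply]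
    rw [avgF_congr h _ _ (Lp.coeFn_add u v)]
    simp only [avgF, Pi.add_apply]
    rw [intervalIntegral.integral_add (avg_ii u _ _) (avg_ii v _ _), mul_add]
  map_smul' a u := by
    rw [RingHom.id_apply, ← MemLp.toLp_const_smul]
    congr 1
    ext t
    simp only [Pi.smul_apply]
    rw [avgF_congr h _ _ (Lp.coeFn_smul a u)]
    simp only [avgF, Pi.smul_apply, smul_eq_mul]
    rw [intervalIntegral.integral_const_mul]
    ring

lemma avgL_bound (h : ℝ) (hh : 0 < h) (c : ℂ) (u : Lp ℂ 2 (volume : Measure ℝ)) :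
    ‖avgL h hh c u‖ ≤ (‖c‖ * (2 * h)) * ‖u‖ := by
  change ‖(avgF_memLp h hh u c).toLp _‖ ≤ _
  rw [Lp.norm_toLp, Lp.norm_def]
  have h1 : eLpNorm (fun t => c * avgF h u t) 2 volume = ‖c‖ₑ * eLpNorm (avgF h u) 2 volume :=
    eLpNorm_const_smul c (avgF h u) 2 volume
  have h2 := avgF_eLpNorm h hh u (Lp.stronglyMeasurable u)
  rw [h1, ENNReal.toReal_mul, toReal_enorm, mul_assoc]
  refine mul_le_mul_of_nonneg_left ?_ (norm_nonneg _)
  have h3 := ENNReal.toReal_mono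
    (ENNReal.mul_ne_top ENNReal.ofReal_ne_top (Lp.memLp u).2.ne) h2
  rwa [ENNReal.toReal_mul, ENNReal.toReal_ofReal (by positivity)] at h3

/-- The averaging operator `(A_h u)(t) = (1/(2 sinh h)) ∫_{t−h}^{t+h} u(s) ds` is a
bounded operator on `L²(ℝ, ℂ)` with operator norm exactly `h / sinh h`. -/
theorem stmt_4 (h : ℝ) (hh : 0 < h) :
    ∃ A : Lp ℂ 2 (volume : Measure ℝ) →L[ℂ] Lp ℂ 2 (volume : Measure ℝ),
      (∀ u : Lp ℂ 2 (volume : Measure ℝ),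
        ∀ᵐ t : ℝ ∂volume,
          (A u : ℝ → ℂ) t
            = ((1 / (2 * Real.sinh h) : ℝ) : ℂ) * ∫ s in (t - h)..(t + h), u s) ∧
      ‖A‖ = h / Real.sinh h := by
  have hs : 0 < Real.sinh h := Real.sinh_pos_iff.2 hh
  set c : ℂ := ((1 / (2 * Real.sinh h) : ℝ) : ℂ) with hc
  have hcn : ‖c‖ = 1 / (2 * Real.sinh h) := by
    rw [hc, Complex.norm_real, Real.norm_of_nonneg (by positivity)]
  have hK : ‖c‖ * (2 * h) = h / Real.sinh h := by
    rw [hcn]; field_simp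
  set K := h / Real.sinh h with hKdef
  have hKpos : 0 < K := by positivity
  have hb : ∀ u, ‖avgL h hh c u‖ ≤ K * ‖u‖ := fun u => hK ▸ avgL_bound h hh c u
  let A := (avgL h hh c).mkContinuous K hb
  have hA : ∀ u : Lp ℂ 2 (volume : Measure ℝ), ∀ᵐ t : ℝ ∂volume,
      (A u : ℝ → ℂ) t = c * ∫ s in (t - h)..(t + h), u s := by
    intro u
    exact (avgF_memLp h hh u c).coeFn_toLp
  refine ⟨A, hA, le_antisymm (LinearMap.mkContinuous_norm_le _ hKpos.le hb) ?_⟩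
  have key : ∀ N : ℝ, h < N → K ^ 2 * (N - h) ≤ ‖A‖ ^ 2 * N := by
    intro N hN
    have f1 : volume (Set.Icc (-N) N) ≠ ⊤ := by simp
    have f2 : volume (Set.Icc (-(N - h)) (N - h)) ≠ ⊤ := by simp
    let u : Lp ℂ 2 (volume : Measure ℝ) := indicatorConstLp 2 measurableSet_Icc f1 (1 : ℂ)
    let v : Lp ℂ 2 (volume : Measure ℝ) := indicatorConstLp 2 measurableSet_Icc f2 (K : ℂ)
    have hle : ‖v‖ ≤ ‖A u‖ := by
      refine Lp.norm_le_norm_of_ae_le ?_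
      have hu : (u : ℝ → ℂ) =ᵐ[volume] (Set.Icc (-N) N).indicator fun _ => (1 : ℂ) :=
        indicatorConstLp_coeFn
      have hv : (v : ℝ → ℂ) =ᵐ[volume] (Set.Icc (-(N - h)) (N - h)).indicator fun _ => (K : ℂ) :=
        indicatorConstLp_coeFn
      filter_upwards [hA u, hv] with t ht1 ht2
      rw [ht1, ht2]
      by_cases htm : t ∈ Set.Icc (-(N - h)) (N - h)
      · rw [Set.indicator_of_mem htm]
        have e1 : ∫ s in (t - h)..(t + h), u s = ((2 * h : ℝ) : ℂ) := by
          have : ∫ s in (t - h)..(t + h), u s = ∫ s in (t - h)..(t + h), (1 : ℂ) := by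
            refine intervalIntegral.integral_congr_ae ?_
            filter_upwards [hu] with x hx hx2
            rw [Set.uIoc_of_le (by linarith)] at hx2
            rw [hx, Set.indicator_of_mem]
            exact ⟨by linarith [htm.1, hx2.1], by linarith [htm.2, hx2.2]⟩
          rw [this, intervalIntegral.integral_const, Complex.real_smul, mul_one]
          congr 1; ring
        rw [e1, norm_mul, Complex.norm_real K, Complex.norm_real (2 * h),
          Real.norm_of_nonneg (by positivity : 0 ≤ 2 * h), hK, Real.norm_of_nonneg hKpos.le]
      · rw [Set.indicator_of_notMem htm, norm_zero]; exact norm_nonneg _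
    have h3 := hle.trans (A.le_opNorm u)
    have nu : ‖u‖ ^ 2 = 2 * N := by
      simp only [u]
      rw [norm_indicatorConstLp (by norm_num) (by norm_num), Measure.real, Real.volume_Icc,
        ENNReal.toReal_ofReal (by linarith), norm_one, one_mul, ENNReal.toReal_ofNat,
        ← Real.sqrt_eq_rpow, Real.sq_sqrt (by linarith)]
      ring
    have nv : ‖v‖ ^ 2 = K ^ 2 * (2 * (N - h)) := by
      simp only [v]
      rw [norm_indicatorConstLp (by norm_num) (by norm_num), Measure.real, Real.volume_Icc,
        ENNReal.toReal_ofReal (by linarith), ENNReal.toReal_ofNat, mul_pow,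
        ← Real.sqrt_eq_rpow, Real.sq_sqrt (by linarith), Complex.norm_real,
        Real.norm_of_nonneg hKpos.le]
      ring
    have h4 := pow_le_pow_left₀ (norm_nonneg v) h3 2
    rw [mul_pow, nu, nv] at h4
    linarith
  by_contra hlt
  push Not at hlt
  have hd : 0 < K ^ 2 - ‖A‖ ^ 2 := by
    have := pow_lt_pow_left₀ hlt (norm_nonneg A) (n := 2) (by norm_num)
    linarith
  have hp : 0 < K ^ 2 * h / (K ^ 2 - ‖A‖ ^ 2) := by positivity
  have := key (K ^ 2 * h / (K ^ 2 - ‖A‖ ^ 2) + h) (by linarith)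
  have e : K ^ 2 * h / (K ^ 2 - ‖A‖ ^ 2) * (K ^ 2 - ‖A‖ ^ 2) = K ^ 2 * h :=
    div_mul_cancel₀ _ hd.ne'
  nlinarith [mul_pos hd hh]
end

section
/- Let h > 0 and let A_h be the bounded operator on L²(ℝ, ℂ) defined by (A_h u)(t) = (1/(2 sinh h)) ∫_{t-h}^{t+h} u(s) ds. Then the spectrum of A_h (as an element of the algebra of bounded operators on L²(ℝ, ℂ)) equals the real interval [A·h/sinh h, h/sinh h] viewed inside ℂ, where A := inf_{x>0} sin(x)/x. -/
open MeasureTheory Real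

theorem exists_mulOp (m : ℝ → ℂ) (hm : Continuous m) (C : ℝ) (hC : ∀ x, ‖m x‖ ≤ C) :
    ∃ M : Lp ℂ 2 (volume : Measure ℝ) →L[ℂ] Lp ℂ 2 (volume : Measure ℝ),
      ∀ v, M v =ᵐ[volume] fun x => m x * v x := by
  have hmem : MemLp m ⊤ (volume : Measure ℝ) :=
    memLp_top_of_bound hm.aestronglyMeasurable C (Filter.Eventually.of_forall hC)
  refine ⟨(ContinuousLinearMap.mul ℂ ℂ).holderL volume ⊤ 2 2 hmem.toLp, fun v => ?_⟩
  rw [ContinuousLinearMap.holderL_apply_apply]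
  filter_upwards [(ContinuousLinearMap.mul ℂ ℂ).coeFn_holder (r := 2) hmem.toLp v,
    hmem.coeFn_toLp] with x h1 h2
  rw [h1, h2]; rfl

theorem spectrum_mulOp (m : ℝ → ℂ) (hm : Continuous m)
    (M : Lp ℂ 2 (volume : Measure ℝ) →L[ℂ] Lp ℂ 2 (volume : Measure ℝ))
    (hM : ∀ v, M v =ᵐ[volume] fun x => m x * v x) :
    spectrum ℂ M = closure (Set.range m) := by
  have hsub : ∀ (l : ℂ) (v : Lp ℂ 2 (volume : Measure ℝ)),
      (algebraMap ℂ _ l - M) v =ᵐ[volume] fun x => (l - m x) * v x := by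
    intro l v
    have : (algebraMap ℂ (Lp ℂ 2 (volume : Measure ℝ) →L[ℂ] Lp ℂ 2 (volume : Measure ℝ)) l - M) v
        = l • v - M v := by
      simp [Algebra.algebraMap_eq_smul_one]
    rw [this]
    filter_upwards [hM v, Lp.coeFn_sub (l • v) (M v), Lp.coeFn_smul l v] with x h1 h2 h3
    rw [h2, Pi.sub_apply, h3, h1, Pi.smul_apply, smul_eq_mul]; ring
  apply Set.Subset.antisymm
  · intro l hl
    by_contra hcl
    apply hl
    rw [Metric.mem_closure_iff] at hcl
    push Not at hcl
    obtain ⟨ε, hε, hd⟩ := hcl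
    have hd' : ∀ x, ε ≤ ‖l - m x‖ := fun x => by
      simpa [dist_eq_norm] using hd (m x) ⟨x, rfl⟩
    have hne : ∀ x, l - m x ≠ 0 := fun x hx => by
      have := hd' x; rw [hx, norm_zero] at this; linarith
    obtain ⟨N, hN⟩ := exists_mulOp (fun x => (l - m x)⁻¹)
      ((continuous_const.sub hm).inv₀ hne) ε⁻¹ (fun x => by
        rw [norm_inv]; exact inv_anti₀ hε (hd' x))
    refine isUnit_iff_exists.2 ⟨N, ?_, ?_⟩
    · ext1 v
      apply Lp.ext
      rw [mul_apply_eq_comp, one_apply_eq_self]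
      filter_upwards [hsub l (N v), hN v] with x h1 h2
      rw [h1, h2, mul_inv_cancel_left₀ (hne x)]
    · ext1 v
      apply Lp.ext
      rw [mul_apply_eq_comp, one_apply_eq_self]
      filter_upwards [hN ((algebraMap ℂ _ l - M) v), hsub l v] with x h1 h2
      rw [h1, h2, inv_mul_cancel_left₀ (hne x)]
  · intro l hl hu
    obtain ⟨N, hN1, hN2⟩ := isUnit_iff_exists.1 hu
    have hNpos : 0 < ‖N‖ + 1 := by positivity
    obtain ⟨_, ⟨x0, rfl⟩, hx0⟩ := Metric.mem_closure_iff.1 hl (‖N‖ + 1)⁻¹ (by positivity)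
    have hopen : IsOpen {x | ‖l - m x‖ < (‖N‖ + 1)⁻¹} :=
      isOpen_lt (continuous_const.sub hm).norm continuous_const
    obtain ⟨δ, hδ, hball⟩ := Metric.isOpen_iff.1 hopen x0 (by simpa [dist_eq_norm] using hx0)
    set u : Lp ℂ 2 (volume : Measure ℝ) :=
      indicatorConstLp 2 (measurableSet_ball (x := x0) (ε := δ)) measure_ball_lt_top.ne 1 with hu_def
    have hupos : 0 < ‖u‖ := by
      rw [hu_def, norm_indicatorConstLp (by norm_num) (by norm_num)]
      have : 0 < (volume : Measure ℝ).real (Metric.ball x0 δ) := by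
        rw [Measure.real, Real.volume_ball, ENNReal.toReal_ofReal (by positivity)]
        positivity
      rw [norm_one, one_mul]
      exact Real.rpow_pos_of_pos this _
    have hbd : ‖(algebraMap ℂ _ l - M) u‖ ≤ (‖N‖ + 1)⁻¹ * ‖u‖ := by
      apply Lp.norm_le_mul_norm_of_ae_le_mul
      filter_upwards [hsub l u, indicatorConstLp_coeFn (p := 2)
        (hs := measurableSet_ball (x := x0) (ε := δ)) (hμs := measure_ball_lt_top.ne)
        (c := (1:ℂ)) (μ := (volume : Measure ℝ))] with x h1 h2
      rw [h1, norm_mul]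
      by_cases hx : x ∈ Metric.ball x0 δ
      · exact mul_le_mul_of_nonneg_right (hball hx).le (norm_nonneg _)
      · have : u x = 0 := by rw [hu_def, h2, Set.indicator_of_notMem hx]
        rw [this]; simp
    have h3 : N ((algebraMap ℂ _ l - M) u) = u := by
      rw [← mul_apply_eq_comp, hN2, one_apply_eq_self]
    have h4 : ‖u‖ ≤ ‖N‖ * ((‖N‖ + 1)⁻¹ * ‖u‖) := by
      calc ‖u‖ = ‖N ((algebraMap ℂ _ l - M) u)‖ := by rw [h3]
        _ ≤ ‖N‖ * ‖(algebraMap ℂ _ l - M) u‖ := N.le_opNorm _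
        _ ≤ _ := by gcongr
    have h5 : ‖N‖ * ((‖N‖ + 1)⁻¹ * ‖u‖) < ‖u‖ := by
      rw [← mul_assoc, ← div_eq_mul_inv]
      have : ‖N‖ / (‖N‖ + 1) < 1 := by rw [div_lt_one hNpos]; linarith
      nlinarith
    linarith

theorem sinc_closure_range :
    closure (Set.range Real.sinc) =
      Set.Icc (sInf ((fun x : ℝ => Real.sin x / x) '' Set.Ioi 0)) 1 := by
  set S := (fun x : ℝ => Real.sin x / x) '' Set.Ioi 0 with hS
  have hmem : ∀ x : ℝ, 0 < x → Real.sinc x ∈ S := fun x hx =>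
    ⟨x, hx, (Real.sinc_of_ne_zero hx.ne').symm⟩
  have hbdd : BddBelow S := by
    refine ⟨-1, ?_⟩
    rintro _ ⟨x, hx, rfl⟩
    have := Real.neg_one_le_sinc x
    rwa [Real.sinc_of_ne_zero (ne_of_gt hx)] at this
  have hle0 : sInf S ≤ 0 := csInf_le hbdd ⟨π, Real.pi_pos, by simp⟩
  have hne : S.Nonempty := ⟨_, hmem 1 one_pos⟩
  apply Set.Subset.antisymm
  · apply closure_minimal _ isClosed_Icc
    rintro _ ⟨x, rfl⟩
    refine ⟨?_, Real.sinc_le_one x⟩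
    rcases lt_trichotomy x 0 with hx | hx | hx
    · rw [← Real.sinc_neg]; exact csInf_le hbdd (hmem _ (by linarith))
    · rw [hx, Real.sinc_zero]; linarith
    · exact csInf_le hbdd (hmem _ hx)
  · rw [← closure_Ioc (by linarith : sInf S ≠ 1)]
    apply closure_mono
    intro y hy
    obtain ⟨_, ⟨x, hx, rfl⟩, hxy⟩ := exists_lt_of_csInf_lt hne hy.1
    have hx' : Real.sin x / x = Real.sinc x := (Real.sinc_of_ne_zero (ne_of_gt hx)).symm
    simp only [hx'] at hxy
    exact (isPreconnected_range Real.continuous_sinc).ordConnected.out ⟨x, rfl⟩ ⟨0, Real.sinc_zero⟩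
      ⟨hxy.le, hy.2⟩

theorem integral_char (h ξ t : ℝ) :
    ∫ s in (t - h)..(t + h), Complex.exp (↑(2 * π * (ξ * s)) * Complex.I) =
      Complex.exp (↑(2 * π * (ξ * t)) * Complex.I) * (2 * h * Real.sinc (2 * π * h * ξ) : ℝ) := by
  have h1 : ∫ s in (t - h)..(t + h), Complex.exp (↑(2 * π * (ξ * s)) * Complex.I)
      = ∫ s in (-h)..h, Complex.exp (↑(2 * π * (ξ * t)) * Complex.I) *
          Complex.exp (↑((2 * π * ξ) * s) * Complex.I) := by
    have := intervalIntegral.integral_comp_add_right (a := -h) (b := h)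
      (fun s : ℝ => Complex.exp (↑(2 * π * (ξ * s)) * Complex.I)) t
    rw [show -h + t = t - h by ring, show h + t = t + h by ring] at this
    rw [← this]
    congr 1; ext s
    rw [← Complex.exp_add]; congr 1; push_cast; ring
  rw [h1, intervalIntegral.integral_const_mul]
  congr 1
  rcases eq_or_ne ξ 0 with rfl | hξ
  · simp; ring
  have hc : 2 * π * ξ ≠ 0 := by positivity
  have := intervalIntegral.integral_comp_mul_left (a := -h) (b := h)
      (fun s : ℝ => Complex.exp (s * Complex.I)) hc
  rw [this, show 2 * π * ξ * -h = -(2 * π * h * ξ) by ring,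
    show 2 * π * ξ * h = 2 * π * h * ξ by ring, integral_exp_mul_I_eq_sinc]
  rw [Complex.real_smul]
  have hξ' : (ξ : ℂ) ≠ 0 := by exact_mod_cast hξ
  have hp : (π : ℂ) ≠ 0 := by exact_mod_cast Real.pi_ne_zero
  push_cast
  field_simp

open FourierTransform SchwartzMap

theorem avg_fourierInv (h : ℝ) (hh : 0 < h) (g : SchwartzMap ℝ ℂ) (t : ℝ) :
    ((1 / (2 * Real.sinh h) : ℝ) : ℂ) * ∫ s in (t - h)..(t + h), 𝓕⁻ (g : ℝ → ℂ) s =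
      𝓕⁻ (fun ξ : ℝ => ((h / Real.sinh h * Real.sinc (2 * π * h * ξ) : ℝ) : ℂ) * g ξ) t := by
  have hsinh : Real.sinh h ≠ 0 := (Real.sinh_pos_iff.2 hh).ne'
  have e : ∀ (f : ℝ → ℂ) (s : ℝ), 𝓕⁻ f s =
      ∫ ξ, Complex.exp (↑(2 * π * (ξ * s)) * Complex.I) * f ξ := by
    intro f s
    rw [Real.fourierInv_eq']
    simp [mul_comm]
  simp_rw [e]
  rw [intervalIntegral.integral_of_le (by linarith), integral_integral_swap]
  · rw [← integral_const_mul]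
    congr 1; ext ξ
    rw [integral_mul_const, ← intervalIntegral.integral_of_le (by linarith), integral_char]
    have : (Complex.sinh h) ≠ 0 := by exact_mod_cast hsinh
    push_cast
    field_simp
  · have h1 : Integrable (fun p : ℝ × ℝ => (1:ℂ) * g p.2)
        ((volume.restrict (Set.Ioc (t - h) (t + h))).prod volume) :=
      Integrable.mul_prod (integrable_const _) g.integrable
    refine h1.mono ?_ ?_
    · apply Continuous.aestronglyMeasurable
      have := g.continuous
      unfold Function.uncurry
      fun_prop
    · refine Filter.Eventually.of_forall fun p => ?_
      simp only [Function.uncurry, norm_mul, Complex.norm_exp_ofReal_mul_I, norm_one, le_refl]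

theorem key (h : ℝ) (hh : 0 < h)
    (A M : Lp ℂ 2 (volume : Measure ℝ) →L[ℂ] Lp ℂ 2 (volume : Measure ℝ))
    (hA : ∀ u : Lp ℂ 2 (volume : Measure ℝ),
      ∀ᵐ t : ℝ ∂volume,
        (A u : ℝ → ℂ) t
          = ((1 / (2 * Real.sinh h) : ℝ) : ℂ) * ∫ s in (t - h)..(t + h), u s)
    (hM : ∀ v, M v =ᵐ[volume] fun ξ =>
      ((h / Real.sinh h * Real.sinc (2 * π * h * ξ) : ℝ) : ℂ) * v ξ)
    (v : Lp ℂ 2 (volume : Measure ℝ)) :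
    A ((Lp.fourierTransformₗᵢ ℝ ℂ).symm v) = (Lp.fourierTransformₗᵢ ℝ ℂ).symm (M v) := by
  have hd : DenseRange (toLpCLM ℂ (E := ℝ) ℂ 2 volume) :=
    denseRange_toLpCLM ENNReal.ofNat_ne_top
  refine DenseRange.induction_on
    (p := fun v => A ((Lp.fourierTransformₗᵢ ℝ ℂ).symm v) =
      (Lp.fourierTransformₗᵢ ℝ ℂ).symm (M v)) hd v ?_ ?_
  · apply isClosed_eq
    · exact A.continuous.comp (Lp.fourierTransformₗᵢ ℝ ℂ).symm.continuous
    · exact (Lp.fourierTransformₗᵢ ℝ ℂ).symm.continuous.comp M.continuous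
  intro g
  refine DenseRange.eq_of_inner_right ℂ hd fun φ => ?_
  rw [← (Lp.fourierTransformₗᵢ ℝ ℂ).inner_map_map _ ((Lp.fourierTransformₗᵢ ℝ ℂ).symm (M _)),
    LinearIsometryEquiv.apply_symm_apply]
  have e1 : (Lp.fourierTransformₗᵢ ℝ ℂ).symm (toLpCLM ℂ (E := ℝ) ℂ 2 volume g) = (𝓕⁻ g).toLp 2 :=
    SchwartzMap.toLp_fourierInv_eq g
  have e2 : (Lp.fourierTransformₗᵢ ℝ ℂ) (toLpCLM ℂ (E := ℝ) ℂ 2 volume φ) = (𝓕 φ).toLp 2 :=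
    SchwartzMap.toLp_fourier_eq φ
  rw [e1, e2, L2.inner_def, L2.inner_def]
  set G : ℝ → ℂ := fun ξ : ℝ => ((h / Real.sinh h * Real.sinc (2 * π * h * ξ) : ℝ) : ℂ) * g ξ
    with hG
  have hGi : Integrable G := by
    refine g.integrable.bdd_mul (c := |h / Real.sinh h|) ?_ ?_
    · apply Continuous.aestronglyMeasurable
      have := Real.continuous_sinc
      fun_prop
    · refine Filter.Eventually.of_forall fun ξ => ?_
      rw [Complex.norm_real, Real.norm_eq_abs, abs_mul]
      exact mul_le_of_le_one_right (abs_nonneg _) (Real.abs_sinc_le_one _)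
  have hswap : ∫ ξ, inner ℂ (𝓕 (φ : ℝ → ℂ) ξ) (G ξ) = ∫ x, inner ℂ (φ x) (𝓕⁻ G x) := by
    simpa using! VectorFourier.integral_sesq_fourierIntegral_eq_neg_flip (innerSL ℂ)
      (L := innerₗ ℝ) continuous_fourierChar continuous_inner φ.integrable hGi
  calc _ = ∫ x, inner ℂ (φ x) (𝓕⁻ G x) := by
        apply integral_congr_ae
        filter_upwards [φ.coeFn_toLp 2 volume, hA ((𝓕⁻ g).toLp 2)] with x h1 h2
        rw [h2, toLpCLM_apply, h1]
        congr 1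
        rw [hG, ← avg_fourierInv h hh g x]
        congr 1
        apply intervalIntegral.integral_congr_ae
        filter_upwards [(𝓕⁻ g).coeFn_toLp 2 volume] with s hs _
        rw [hs, SchwartzMap.fourierInv_coe]
    _ = ∫ ξ, inner ℂ (𝓕 (φ : ℝ → ℂ) ξ) (G ξ) := hswap.symm
    _ = _ := by
        apply integral_congr_ae
        filter_upwards [(𝓕 φ).coeFn_toLp 2 volume, hM (toLpCLM ℂ (E := ℝ) ℂ 2 volume g),
          g.coeFn_toLp 2 volume] with x h1 h2 h3
        rw [h1, h2, toLpCLM_apply, h3, SchwartzMap.fourier_coe]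

/-- The spectrum of the averaging operator
`(A_h u)(t) = (1/(2 sinh h)) ∫_{t−h}^{t+h} u(s) ds` on `L²(ℝ, ℂ)` is the real interval
`[A·h/sinh h, h/sinh h]` inside `ℂ`, where `A = inf_{x>0} sin x / x`. -/
theorem stmt_5 (h : ℝ) (hh : 0 < h)
    (A : Lp ℂ 2 (volume : Measure ℝ) →L[ℂ] Lp ℂ 2 (volume : Measure ℝ))
    (hA : ∀ u : Lp ℂ 2 (volume : Measure ℝ),
      ∀ᵐ t : ℝ ∂volume,
        (A u : ℝ → ℂ) t
          = ((1 / (2 * Real.sinh h) : ℝ) : ℂ) * ∫ s in (t - h)..(t + h), u s) :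
    spectrum ℂ A
      = (fun x : ℝ => (x : ℂ)) ''
          Set.Icc (sInf ((fun x : ℝ => Real.sin x / x) '' Set.Ioi 0) * h / Real.sinh h)
            (h / Real.sinh h) := by
  have hs : 0 < Real.sinh h := Real.sinh_pos_iff.2 hh
  have hmc : Continuous fun ξ : ℝ =>
      ((h / Real.sinh h * Real.sinc (2 * π * h * ξ) : ℝ) : ℂ) := by
    have := Real.continuous_sinc
    fun_prop
  obtain ⟨M, hM⟩ := exists_mulOp (fun ξ : ℝ =>
      ((h / Real.sinh h * Real.sinc (2 * π * h * ξ) : ℝ) : ℂ)) hmc |h / Real.sinh h| (fun ξ => by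
      rw [Complex.norm_real, Real.norm_eq_abs, abs_mul]
      exact mul_le_of_le_one_right (abs_nonneg _) (Real.abs_sinc_le_one _))
  have hconj : (Lp.fourierTransformₗᵢ ℝ ℂ).toContinuousLinearEquiv.conjContinuousAlgEquiv A
      = M := by
    ext1 v
    rw [ContinuousLinearEquiv.conjContinuousAlgEquiv_apply_apply]
    have := key h hh A M hA hM v
    exact (congrArg (Lp.fourierTransformₗᵢ ℝ ℂ) this).trans
      ((Lp.fourierTransformₗᵢ ℝ ℂ).apply_symm_apply _)
  rw [← AlgEquiv.spectrum_eq
    (Lp.fourierTransformₗᵢ ℝ ℂ).toContinuousLinearEquiv.conjContinuousAlgEquiv A, hconj,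
    spectrum_mulOp _ hmc M hM]
  have hr : (Set.range fun ξ : ℝ => ((h / Real.sinh h * Real.sinc (2 * π * h * ξ) : ℝ) : ℂ))
      = (fun x : ℝ => (x : ℂ)) '' ((fun y => h / Real.sinh h * y) '' Set.range Real.sinc) := by
    ext z
    constructor
    · rintro ⟨ξ, rfl⟩
      exact ⟨_, ⟨_, ⟨_, rfl⟩, rfl⟩, rfl⟩
    · rintro ⟨_, ⟨_, ⟨y, rfl⟩, rfl⟩, rfl⟩
      refine ⟨y / (2 * π * h), ?_⟩
      have : 2 * π * h * (y / (2 * π * h)) = y := by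
        have := Real.pi_pos
        field_simp
      simp only [this]
  have hc : 0 < h / Real.sinh h := by positivity
  have h1 : closure ((fun x : ℝ => (x : ℂ)) ''
      ((fun y => h / Real.sinh h * y) '' Set.range Real.sinc)) =
      (fun x : ℝ => (x : ℂ)) '' closure ((fun y => h / Real.sinh h * y) '' Set.range Real.sinc) :=
    Complex.isometry_ofReal.isClosedEmbedding.closure_image_eq _
  have h2 : closure ((fun y => h / Real.sinh h * y) '' Set.range Real.sinc) =
      (fun y => h / Real.sinh h * y) '' closure (Set.range Real.sinc) :=
    ((Homeomorph.mulLeft₀ (h / Real.sinh h) hc.ne').image_closure _).symm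
  rw [hr, h1, h2, sinc_closure_range, Set.image_mul_left_Icc' hc]
  congr 2 <;> ring
end

section
/- Let h > 0 and λ ∈ ℝ with λ ≠ 0, and let A_h be the operator on L²(ℝ, ℂ) defined by (A_h u)(t) = (1/(2 sinh h)) ∫_{t-h}^{t+h} u(s) ds. Define u_n(t) = 2^{-n/2} e^{iλt} 𝟙_{[2^n, 2^{n+1}]}(t) for n ∈ ℕ. Then there exists C > 0 (depending on h and λ) such that for all n ∈ ℕ, ‖ A_h u_n − (sin(λh)/(λ sinh h)) u_n ‖_{L²(ℝ)} ≤ C 2^{-n/2}. -/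
open MeasureTheory Real Set

lemma aux_norm (lam c : ℝ) (hc : 0 ≤ c) (a b t : ℝ) :
    ‖Set.indicator (Set.Icc a b) (fun r : ℝ => (c : ℂ) * Complex.exp (Complex.I * lam * r)) t‖ ≤ c := by
  refine (norm_indicator_le_norm_self _ _).trans ?_
  have : Complex.I * lam * t = ((lam * t : ℝ) : ℂ) * Complex.I := by push_cast; ring
  rw [norm_mul, this, Complex.norm_exp_ofReal_mul_I, Complex.norm_real, Real.norm_of_nonneg hc, mul_one]

lemma aux_int (h lam c t : ℝ) (hlam : lam ≠ 0) :
    ∫ s in (t - h)..(t + h), (c : ℂ) * Complex.exp (Complex.I * lam * (s : ℝ)) =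
      (c : ℂ) * Complex.exp (Complex.I * lam * t) * (2 * (Real.sin (lam * h) : ℂ) / lam) := by
  have hl : (lam : ℂ) ≠ 0 := by exact_mod_cast hlam
  have hne : Complex.I * lam ≠ 0 := mul_ne_zero Complex.I_ne_zero hl
  rw [intervalIntegral.integral_const_mul, integral_exp_mul_complex hne]
  have e1 : Complex.exp (Complex.I * lam * ((t + h : ℝ) : ℂ)) =
      Complex.exp (Complex.I * lam * t) * Complex.exp ((lam * h : ℂ) * Complex.I) := by
    rw [← Complex.exp_add]; congr 1; push_cast; ring
  have e2 : Complex.exp (Complex.I * lam * ((t - h : ℝ) : ℂ)) =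
      Complex.exp (Complex.I * lam * t) * Complex.exp (-(lam * h : ℂ) * Complex.I) := by
    rw [← Complex.exp_add]; congr 1; push_cast; ring
  rw [e1, e2]
  push_cast
  rw [Complex.sin]
  generalize Complex.exp ((lam * h : ℂ) * Complex.I) = x
  generalize Complex.exp (-(lam * h : ℂ) * Complex.I) = y
  field_simp
  linear_combination (c : ℂ) * (x - y) * Complex.I_sq

lemma aux_zero (h lam c a b t : ℝ) (hh : 0 < h) (hlam : lam ≠ 0) (hab : a ≤ b)
    (ht : t ∉ Set.Icc (a - h) (a + h) ∪ Set.Icc (b - h) (b + h)) :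
    ((1 / (2 * Real.sinh h) : ℝ) : ℂ)
              * (∫ s in (t - h)..(t + h),
                  Set.indicator (Set.Icc a b)
                    (fun r : ℝ => (c : ℂ) * Complex.exp (Complex.I * lam * r)) s)
            - ((Real.sin (lam * h) / (lam * Real.sinh h) : ℝ) : ℂ)
              * Set.indicator (Set.Icc a b)
                  (fun r : ℝ => (c : ℂ) * Complex.exp (Complex.I * lam * r)) t = 0 := by
  simp only [Set.mem_union, Set.mem_Icc, not_or, not_and_or, not_le] at ht
  by_cases hm : a + h < t ∧ t < b - h
  · obtain ⟨h1, h2⟩ := hm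
    have e : ∫ s in (t - h)..(t + h), Set.indicator (Set.Icc a b)
        (fun r : ℝ => (c : ℂ) * Complex.exp (Complex.I * lam * r)) s
        = ∫ s in (t - h)..(t + h), (c : ℂ) * Complex.exp (Complex.I * lam * (s : ℝ)) := by
      apply intervalIntegral.integral_congr
      intro s hs
      rw [Set.uIcc_of_le (by linarith)] at hs
      have hm : s ∈ Set.Icc a b := ⟨by linarith [hs.1], by linarith [hs.2]⟩
      exact Set.indicator_of_mem hm _
    have hm : t ∈ Set.Icc a b := ⟨by linarith, by linarith⟩
    rw [e, aux_int h lam c t hlam, Set.indicator_of_mem hm]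
    have hl : (lam : ℂ) ≠ 0 := by exact_mod_cast hlam
    have hs : (Real.sinh h : ℂ) ≠ 0 := by
      exact_mod_cast (Real.sinh_pos_iff.mpr hh).ne'
    rw [Complex.ofReal_div, Complex.ofReal_div, Complex.ofReal_mul, Complex.ofReal_mul]
    push_cast at hs ⊢
    field_simp
    ring
  · have ho : t < a - h ∨ b + h < t := by
      by_contra hcon
      push Not at hcon hm
      rcases ht with ⟨h1 | h1, h2 | h2⟩ <;> first | linarith [hcon.1, hcon.2] | linarith [hcon.1, hcon.2, hm h1]
    have hz : ∀ s ∈ Set.Icc (t - h) (t + h), Set.indicator (Set.Icc a b)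
        (fun r : ℝ => (c : ℂ) * Complex.exp (Complex.I * lam * r)) s = 0 := by
      intro s hs
      apply Set.indicator_of_notMem
      rintro ⟨h1, h2⟩
      rcases ho with h3 | h3
      · linarith [hs.2]
      · linarith [hs.1]
    rw [hz t ⟨by linarith, by linarith⟩, intervalIntegral.integral_congr (g := fun _ => 0)]
    · simp
    · intro s hs
      rw [Set.uIcc_of_le (by linarith)] at hs
      exact hz s hs

lemma aux_main (h lam c a b : ℝ) (hh : 0 < h) (hlam : lam ≠ 0) (hc : 0 ≤ c) (hab : a ≤ b) :
    eLpNorm (fun t : ℝ => ((1 / (2 * Real.sinh h) : ℝ) : ℂ)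
              * (∫ s in (t - h)..(t + h),
                  Set.indicator (Set.Icc a b)
                    (fun r : ℝ => (c : ℂ) * Complex.exp (Complex.I * lam * r)) s)
            - ((Real.sin (lam * h) / (lam * Real.sinh h) : ℝ) : ℂ)
              * Set.indicator (Set.Icc a b)
                  (fun r : ℝ => (c : ℂ) * Complex.exp (Complex.I * lam * r)) t) 2 volume
      ≤ ENNReal.ofReal (((1 / (2 * Real.sinh h) * (2 * h) +
          |Real.sin (lam * h) / (lam * Real.sinh h)|) * (4 * h) ^ (1 / 2 : ℝ)) * c) := by
  have hsh := Real.sinh_pos_iff.mpr hh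
  set K := 1 / (2 * Real.sinh h) * (2 * h) + |Real.sin (lam * h) / (lam * Real.sinh h)| with hK
  have hK0 : 0 ≤ K := by positivity
  set S := Set.Icc (a - h) (a + h) ∪ Set.Icc (b - h) (b + h) with hS
  have hSm : MeasurableSet S := measurableSet_Icc.union measurableSet_Icc
  have hvol : volume S ≤ ENNReal.ofReal (4 * h) := by
    refine (measure_union_le _ _).trans ?_
    rw [Real.volume_Icc, Real.volume_Icc, ← ENNReal.ofReal_add (by linarith) (by linarith)]
    apply ENNReal.ofReal_le_ofReal
    linarith
  refine (eLpNorm_mono_real (g := S.indicator (fun _ => K * c)) ?_).trans ?_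
  · intro t
    by_cases ht : t ∈ S
    · rw [Set.indicator_of_mem ht]
      refine (norm_sub_le _ _).trans ?_
      rw [norm_mul, norm_mul, Complex.norm_real, Complex.norm_real, hK, add_mul]
      have hi := intervalIntegral.norm_integral_le_of_norm_le_const
        (a := t - h) (b := t + h) (C := c)
        (f := Set.indicator (Set.Icc a b)
          (fun r : ℝ => (c : ℂ) * Complex.exp (Complex.I * lam * r)))
        (fun s _ => aux_norm lam c hc a b s)
      have e : |t + h - (t - h)| = 2 * h := by
        rw [abs_of_nonneg] <;> linarith
      rw [e] at hi
      have h0 : (0:ℝ) ≤ 1 / (2 * Real.sinh h) := by positivity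
      rw [Real.norm_of_nonneg h0, mul_assoc (1 / (2 * Real.sinh h)), mul_comm (2 * h) c]
      exact add_le_add (mul_le_mul_of_nonneg_left hi h0)
        (mul_le_mul_of_nonneg_left (aux_norm lam c hc a b t) (abs_nonneg _))
    · rw [Set.indicator_of_notMem ht, aux_zero h lam c a b t hh hlam hab ht, norm_zero]
  · rw [eLpNorm_indicator_const hSm (by norm_num) (by norm_num)]
    have e : K * (4 * h) ^ (1 / 2 : ℝ) * c = (K * c) * (4 * h) ^ (1 / 2 : ℝ) := by ring
    rw [e, ENNReal.ofReal_mul (by positivity), Real.enorm_of_nonneg (by positivity),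
      ← ENNReal.ofReal_rpow_of_pos (by positivity)]
    simp only [ENNReal.toReal_ofNat]
    gcongr

/-- The Weyl sequence `u_n(t) = 2^{-n/2} e^{iλt} 𝟙_{[2ⁿ, 2ⁿ⁺¹]}(t)` satisfies
`‖A_h u_n − (sin(λh)/(λ sinh h)) u_n‖_{L²} ≤ C 2^{-n/2}` where
`(A_h u)(t) = (1/(2 sinh h)) ∫_{t−h}^{t+h} u(s) ds`. -/
theorem stmt_7 (h lam : ℝ) (hh : 0 < h) (hlam : lam ≠ 0) :
    ∃ C > (0 : ℝ), ∀ n : ℕ,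
      eLpNorm
        (fun t : ℝ =>
          ((1 / (2 * Real.sinh h) : ℝ) : ℂ)
              * (∫ s in (t - h)..(t + h),
                  Set.indicator (Set.Icc ((2 : ℝ) ^ n) ((2 : ℝ) ^ (n + 1)))
                    (fun r : ℝ => ((2 : ℝ) ^ (-(n : ℝ) / 2) : ℝ)
                      * Complex.exp (Complex.I * lam * r)) s)
            - ((Real.sin (lam * h) / (lam * Real.sinh h) : ℝ) : ℂ)
              * Set.indicator (Set.Icc ((2 : ℝ) ^ n) ((2 : ℝ) ^ (n + 1)))
                  (fun r : ℝ => ((2 : ℝ) ^ (-(n : ℝ) / 2) : ℝ)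
                    * Complex.exp (Complex.I * lam * r)) t)
        2 (volume : Measure ℝ)
      ≤ ENNReal.ofReal (C * (2 : ℝ) ^ (-(n : ℝ) / 2)) := by
  have hsh := Real.sinh_pos_iff.mpr hh
  refine ⟨(1 / (2 * Real.sinh h) * (2 * h) +
          |Real.sin (lam * h) / (lam * Real.sinh h)|) * (4 * h) ^ (1 / 2 : ℝ), by positivity, ?_⟩
  intro n
  exact aux_main h lam _ _ _ hh hlam (by positivity)
    (pow_le_pow_right₀ (by norm_num) (Nat.le_succ n))
end

section
/- There exist C > 0 and h₀ > 0 such that for every h ∈ (0, h₀] and every measurable function f : [0, ∞) → ℝ, ∬_{t, t' ≥ 0, |t − t'| ≤ h} (f(t) − f(t'))² e^{-t - t'} dt dt' ≥ C h⁴ ∬_{t, t' ≥ 0} (f(t) − f(t'))² e^{-2t - 2t'} dt dt'. -/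
open MeasureTheory Real

/-- The Dirichlet-form integrand, extended by zero. -/
noncomputable def dirInt (h : ℝ) (f : ℝ → ℝ) (t u : ℝ) : ENNReal :=
  Set.indicator {p : ℝ × ℝ | 0 ≤ p.1 ∧ 0 ≤ p.2 ∧ |p.1 - p.2| ≤ h}
    (fun p => ENNReal.ofReal ((f p.1 - f p.2) ^ 2 * Real.exp (-p.1 - p.2))) (t, u)

/-- Dirichlet form as an iterated integral. -/
noncomputable def dirF (h : ℝ) (f : ℝ → ℝ) : ENNReal := ∫⁻ t, ∫⁻ u, dirInt h f t u

/-- Weighted distance to the constant c. -/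
noncomputable def XF (f : ℝ → ℝ) (c : ℝ) : ENNReal :=
  ∫⁻ t in Set.Ici (0:ℝ), ENNReal.ofReal ((f t - c) ^ 2 * Real.exp (-2 * t))

/-- Local part of `XF`. -/
noncomputable def X0 (f : ℝ → ℝ) (h c : ℝ) : ENNReal :=
  ∫⁻ t in Set.Icc (0:ℝ) h, ENNReal.ofReal ((f t - c) ^ 2 * Real.exp (-2 * t))

/-- Shift energy. -/
noncomputable def AF (f : ℝ → ℝ) (s : ℝ) : ENNReal :=
  ∫⁻ t in Set.Ici (0:ℝ), ENNReal.ofReal ((f (t + s) - f t) ^ 2 * Real.exp (-2 * t))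

lemma measSet (h : ℝ) : MeasurableSet {p : ℝ × ℝ | 0 ≤ p.1 ∧ 0 ≤ p.2 ∧ |p.1 - p.2| ≤ h} := by
  apply IsClosed.measurableSet
  have a1 : IsClosed {p : ℝ × ℝ | 0 ≤ p.1} := isClosed_le (by fun_prop) (by fun_prop)
  have a2 : IsClosed {p : ℝ × ℝ | 0 ≤ p.2} := isClosed_le (by fun_prop) (by fun_prop)
  have a3 : IsClosed {p : ℝ × ℝ | |p.1 - p.2| ≤ h} := isClosed_le (by fun_prop) (by fun_prop)
  exact a1.inter (a2.inter a3)

lemma dirF_eq (h : ℝ) (f : ℝ → ℝ) (hf : Measurable f) :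
    ∫⁻ p in {p : ℝ × ℝ | 0 ≤ p.1 ∧ 0 ≤ p.2 ∧ |p.1 - p.2| ≤ h},
            ENNReal.ofReal ((f p.1 - f p.2) ^ 2 * Real.exp (-p.1 - p.2))
              ∂(volume : Measure (ℝ × ℝ)) = dirF h f := by
  rw [← lintegral_indicator (measSet h), Measure.volume_eq_prod, lintegral_prod]
  · rfl
  · apply Measurable.aemeasurable
    apply Measurable.indicator _ (measSet h)
    fun_prop

lemma exp_le_three {h : ℝ} (h1 : h ≤ 1) : Real.exp h ≤ 3 := by
  have := Real.exp_one_lt_d9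
  have := Real.exp_le_exp.2 h1
  linarith

lemma key_pt {h : ℝ} (h1 : h ≤ 1) (f : ℝ → ℝ) (t u : ℝ) (ht : 0 ≤ t) (hu : 0 ≤ u)
    (htu : |t - u| ≤ h) :
    ENNReal.ofReal ((f u - f t) ^ 2 * Real.exp (-2 * t)) ≤ 3 * dirInt h f t u := by
  have hm : (t, u) ∈ {p : ℝ × ℝ | 0 ≤ p.1 ∧ 0 ≤ p.2 ∧ |p.1 - p.2| ≤ h} := ⟨ht, hu, htu⟩
  rw [dirInt, Set.indicator_of_mem hm,
    show (3 : ENNReal) = ENNReal.ofReal 3 by simp, ← ENNReal.ofReal_mul (by norm_num)]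
  apply ENNReal.ofReal_le_ofReal
  have e : Real.exp (-2 * t) = Real.exp (u - t) * Real.exp (-t - u) := by
    rw [← Real.exp_add]; congr 1; ring
  have e3 : Real.exp (u - t) ≤ 3 := exp_le_three (by linarith [(abs_le.1 htu).1])
  simp only
  rw [e, show (f u - f t) ^ 2 = (f t - f u) ^ 2 by ring]
  have : 0 ≤ (f t - f u) ^ 2 * Real.exp (-t - u) := by positivity
  nlinarith

lemma B1 {h : ℝ} (h0 : 0 < h) (h1 : h ≤ 1) (f : ℝ → ℝ) (hf : Measurable f) :
    ∫⁻ s in Set.Icc (h/2) h, AF f s ≤ 3 * dirF h f := by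
  unfold AF
  rw [lintegral_lintegral_swap (by apply Measurable.aemeasurable; unfold Function.uncurry; fun_prop)]
  rw [← lintegral_indicator measurableSet_Ici, dirF, ← lintegral_const_mul' _ _ (by simp)]
  apply lintegral_mono
  intro t
  by_cases ht : t ∈ Set.Ici (0:ℝ)
  · simp only [Set.indicator_of_mem ht]
    rw [← lintegral_indicator measurableSet_Icc, ← lintegral_const_mul' _ _ (by simp),
      ← lintegral_sub_right_eq_self _ t]
    apply lintegral_mono
    intro u
    by_cases hu : u - t ∈ Set.Icc (h/2) h
    · simp only [Set.indicator_of_mem hu]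
      have ht' : 0 ≤ t := ht
      have := key_pt h1 f t u ht (by linarith [hu.1]) (by rw [abs_le]; constructor <;> linarith [hu.1, hu.2])
      simpa using this
    · simp only [Set.indicator_of_notMem hu]; exact zero_le
  · simp only [Set.indicator_of_notMem ht]; exact zero_le

lemma B2 {h : ℝ} (h1 : h ≤ 1) (f : ℝ → ℝ) (hf : Measurable f) :
    ∫⁻ u in Set.Icc 0 h, X0 f h (f u) ≤ 3 * dirF h f := by
  unfold X0
  rw [lintegral_lintegral_swap (by apply Measurable.aemeasurable; unfold Function.uncurry; fun_prop)]
  rw [← lintegral_indicator measurableSet_Icc, dirF, ← lintegral_const_mul' _ _ (by simp)]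
  apply lintegral_mono
  intro t
  by_cases ht : t ∈ Set.Icc (0:ℝ) h
  · simp only [Set.indicator_of_mem ht]
    rw [← lintegral_indicator measurableSet_Icc, ← lintegral_const_mul' _ _ (by simp)]
    apply lintegral_mono
    intro u
    by_cases hu : u ∈ Set.Icc 0 h
    · simp only [Set.indicator_of_mem hu]
      rw [show (f t - f u) ^ 2 = (f u - f t) ^ 2 by ring]
      exact key_pt h1 f t u ht.1 hu.1
        (by rw [abs_le]; constructor <;> linarith [hu.1, hu.2, ht.1, ht.2])
    · simp only [Set.indicator_of_notMem hu]; exact zero_le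
  · simp only [Set.indicator_of_notMem ht]; exact zero_le

lemma mass : ∫⁻ t in Set.Ici (0:ℝ), ENNReal.ofReal (Real.exp (-2 * t)) = ENNReal.ofReal (1/2) := by
  rw [setLIntegral_congr Ioi_ae_eq_Ici.symm, ← ofReal_integral_eq_lintegral_ofReal]
  · rw [integral_exp_mul_Ioi (by norm_num)]; norm_num
  · exact (integrableOn_exp_mul_Ioi (by norm_num) 0)
  · exact Filter.Eventually.of_forall fun t => (Real.exp_pos _).le

lemma X_fin (f : ℝ → ℝ) (N : ℝ) (hN : ∀ t, |f t| ≤ N) (c : ℝ) : XF f c ≠ ⊤ := by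
  have : XF f c ≤ ENNReal.ofReal ((N + |c|)^2) *
      ∫⁻ t in Set.Ici (0:ℝ), ENNReal.ofReal (Real.exp (-2 * t)) := by
    rw [XF, ← lintegral_const_mul' _ _ (by simp)]
    apply lintegral_mono
    intro t
    simp only
    rw [← ENNReal.ofReal_mul (by positivity)]
    apply ENNReal.ofReal_le_ofReal
    apply mul_le_mul_of_nonneg_right _ (Real.exp_pos _).le
    apply sq_le_sq'
    · have := abs_le.1 (hN t); have := neg_abs_le c; have := le_abs_self c; linarith
    · have := abs_le.1 (hN t); have := neg_abs_le c; have := le_abs_self c; linarith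
  rw [mass] at this
  exact ne_top_of_le_ne_top (ENNReal.mul_ne_top (by simp) (by simp)) this

lemma pt_ineq {s : ℝ} (s0 : 0 < s) (s1 : s ≤ 1) (a b c t : ℝ) :
    (b - c) ^ 2 * Real.exp (-2 * (t + s)) ≤
      (1 - s/2) * ((a - c) ^ 2 * Real.exp (-2 * t)) + 2 / s * ((b - a) ^ 2 * Real.exp (-2 * t)) := by
  have e : Real.exp (-2 * (t + s)) = Real.exp (-2 * s) * Real.exp (-2 * t) := by
    rw [← Real.exp_add]; congr 1; ring
  have hE : Real.exp (-2 * s) * (1 + s) ≤ 1 - s / 2 := by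
    have h1 : Real.exp (-2*s) = Real.exp (-s) * Real.exp (-s) := by
      rw [← Real.exp_add]; congr 1; ring
    have h2 : Real.exp (-s) * (1 + s) ≤ 1 := by
      have := Real.add_one_le_exp s
      have h3 : Real.exp (-s) * Real.exp s = 1 := by rw [← Real.exp_add]; simp
      nlinarith [Real.exp_pos (-s)]
    have h4 : Real.exp (-s) ≤ 1 - s/2 := by
      have h5 : 0 < Real.exp (-s) := Real.exp_pos _
      by_contra hc
      push Not at hc
      nlinarith
    rw [h1]
    nlinarith [Real.exp_pos (-s)]
  have hE1 : Real.exp (-2 * s) ≤ 1 := by rw [Real.exp_le_one_iff]; linarith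
  have hp : (b - c)^2 ≤ (1 + s) * (a - c)^2 + (1 + 1/s) * (b-a)^2 := by
    have : (1 + s) * (a - c)^2 + (1 + 1/s) * (b-a)^2 - (b - c)^2 = (s * (a - c) - (b - a))^2 / s := by
      field_simp; ring
    have : 0 ≤ (s * (a - c) - (b - a))^2 / s := by positivity
    linarith
  have h6 : 1 + 1/s ≤ 2/s := by
    rw [show 1 + 1/s = (s+1)/s by field_simp]
    gcongr; linarith
  have hx : Real.exp (-2 * s) * (b - c)^2 ≤ (1 - s/2) * (a-c)^2 + 2/s * (b-a)^2 := by
    have E0 := Real.exp_pos (-2 * s)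
    calc _ ≤ Real.exp (-2 * s) * ((1 + s) * (a - c)^2 + (1 + 1/s) * (b-a)^2) := by gcongr
      _ = (Real.exp (-2 * s) * (1 + s)) * (a - c)^2 + Real.exp (-2 * s) * ((1 + 1/s) * (b-a)^2) := by ring
      _ ≤ (1 - s/2) * (a-c)^2 + 1 * (2/s * (b-a)^2) := by gcongr
      _ = _ := by ring
  rw [e]
  have := mul_le_mul_of_nonneg_right hx (Real.exp_pos (-2 * t)).le
  linarith

lemma contr {s : ℝ} (s0 : 0 < s) (s1 : s ≤ 1) (f : ℝ → ℝ) (hf : Measurable f) (N : ℝ)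
    (hN : ∀ t, |f t| ≤ N) (c : ℝ) :
    ENNReal.ofReal (s/2) * XF f c ≤ X0 f s c + ENNReal.ofReal (2/s) * AF f s := by
  have hsplit : XF f c ≤ X0 f s c +
      ∫⁻ t in Set.Ici s, ENNReal.ofReal ((f t - c) ^ 2 * Real.exp (-2 * t)) := by
    rw [XF, X0, ← Set.Icc_union_Ici_eq_Ici s0.le]
    exact lintegral_union_le _ _ _
  have hshift : ∫⁻ t in Set.Ici s, ENNReal.ofReal ((f t - c) ^ 2 * Real.exp (-2 * t)) ≤
      ENNReal.ofReal (1 - s/2) * XF f c + ENNReal.ofReal (2/s) * AF f s := by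
    rw [← lintegral_indicator measurableSet_Ici, ← lintegral_add_right_eq_self _ s, XF, AF,
      ← lintegral_const_mul' _ _ (by simp), ← lintegral_const_mul' _ _ (by simp),
      ← lintegral_add_left (by fun_prop), ← lintegral_indicator measurableSet_Ici]
    apply lintegral_mono
    intro t
    by_cases ht : t ∈ Set.Ici (0:ℝ)
    · have ht' : t + s ∈ Set.Ici s := by simpa using ht
      simp only [Set.indicator_of_mem ht, Set.indicator_of_mem ht']
      rw [← ENNReal.ofReal_mul (by linarith), ← ENNReal.ofReal_mul (by positivity),
        ← ENNReal.ofReal_add (mul_nonneg (by linarith) (by positivity)) (by positivity)]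
      exact ENNReal.ofReal_le_ofReal (pt_ineq s0 s1 _ _ _ _)
    · have ht' : t + s ∉ Set.Ici s := by simpa using ht
      simp only [Set.indicator_of_notMem ht']; exact zero_le
  have hX := X_fin f N hN c
  have hdec : XF f c = ENNReal.ofReal (s/2) * XF f c + ENNReal.ofReal (1 - s/2) * XF f c := by
    rw [← add_mul, ← ENNReal.ofReal_add (by linarith) (by linarith)]
    simp
  have hfin : ENNReal.ofReal (1 - s/2) * XF f c ≠ ⊤ := ENNReal.mul_ne_top (by simp) hX
  rw [← ENNReal.add_le_add_iff_right hfin, ← hdec]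
  calc XF f c ≤ _ := hsplit.trans (add_le_add_right hshift _)
    _ = _ := by ring

/-- The variance side. -/
noncomputable def VF (f : ℝ → ℝ) : ENNReal :=
  ∫⁻ p in {p : ℝ × ℝ | 0 ≤ p.1 ∧ 0 ≤ p.2},
            ENNReal.ofReal ((f p.1 - f p.2) ^ 2 * Real.exp (-2 * p.1 - 2 * p.2))
              ∂(volume : Measure (ℝ × ℝ))

lemma V_le (f : ℝ → ℝ) (hf : Measurable f) (c : ℝ) : VF f ≤ 2 * XF f c := by
  have hset : {p : ℝ × ℝ | 0 ≤ p.1 ∧ 0 ≤ p.2} = Set.Ici 0 ×ˢ Set.Ici 0 := by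
    ext p; rfl
  rw [VF, hset, Measure.volume_eq_prod, ← Measure.prod_restrict, lintegral_prod _ (by fun_prop)]
  have hin : ∀ t : ℝ, ∫⁻ u in Set.Ici (0:ℝ),
      ENNReal.ofReal ((f t - f u) ^ 2 * Real.exp (-2 * t - 2 * u)) ≤
      ENNReal.ofReal ((f t - c)^2 * Real.exp (-2 * t))
        + ENNReal.ofReal (2 * Real.exp (-2 * t)) * XF f c := by
    intro t
    have h1 : ENNReal.ofReal ((f t - c)^2 * Real.exp (-2 * t)) =
        ENNReal.ofReal (2 * ((f t - c)^2 * Real.exp (-2 * t))) *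
        ∫⁻ u in Set.Ici (0:ℝ), ENNReal.ofReal (Real.exp (-2 * u)) := by
      rw [mass, ← ENNReal.ofReal_mul (by positivity)]; congr 1; ring
    rw [h1, XF, ← lintegral_const_mul' _ _ ENNReal.ofReal_ne_top,
      ← lintegral_const_mul' _ _ ENNReal.ofReal_ne_top,
      ← lintegral_add_left (by fun_prop)]
    apply lintegral_mono
    intro u
    simp only
    rw [← ENNReal.ofReal_mul (by positivity), ← ENNReal.ofReal_mul (by positivity),
        ← ENNReal.ofReal_add (by positivity) (by positivity)]
    apply ENNReal.ofReal_le_ofReal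
    have e : Real.exp (-2 * t - 2 * u) = Real.exp (-2 * t) * Real.exp (-2 * u) := by
      rw [← Real.exp_add]; congr 1; ring
    rw [e]
    have hp : (f t - f u)^2 ≤ 2 * (f t - c)^2 + 2 * (f u - c)^2 := by
      nlinarith [sq_nonneg (f t - c + (f u - c))]
    have := mul_le_mul_of_nonneg_right hp
      (by positivity : 0 ≤ Real.exp (-2 * t) * Real.exp (-2 * u))
    linarith
  refine (lintegral_mono hin).trans ?_
  rw [lintegral_add_left (by fun_prop), lintegral_mul_const _ (by fun_prop)]
  have h2 : ∫⁻ t in Set.Ici (0:ℝ), ENNReal.ofReal (2 * Real.exp (-2 * t)) = 1 := by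
    simp_rw [ENNReal.ofReal_mul (show (0:ℝ) ≤ 2 by norm_num)]
    rw [lintegral_const_mul' _ _ (by simp), mass, ← ENNReal.ofReal_mul (by norm_num)]
    norm_num
  rw [h2, ← XF, one_mul, two_mul]

lemma bdd_case {h : ℝ} (h0 : 0 < h) (h1 : h ≤ 1) (f : ℝ → ℝ) (hf : Measurable f) (N : ℝ)
    (hN : ∀ t, |f t| ≤ N) :
    ENNReal.ofReal (1/300 * h ^ 4) * VF f ≤ dirF h f := by
  -- step 1
  have s1 : ∀ c, ∀ s ∈ Set.Icc (h/2) h,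
      ENNReal.ofReal (h/8) * VF f ≤ X0 f h c + ENNReal.ofReal (4/h) * AF f s := by
    intro c s hs
    have sp : 0 < s := by linarith [hs.1]
    calc ENNReal.ofReal (h/8) * VF f ≤ ENNReal.ofReal (h/8) * (2 * XF f c) := by
          gcongr; exact V_le f hf c
      _ = ENNReal.ofReal (h/4) * XF f c := by
          rw [← mul_assoc, show (2 : ENNReal) = ENNReal.ofReal 2 by simp,
            ← ENNReal.ofReal_mul (by positivity)]
          congr 2; ring
      _ ≤ ENNReal.ofReal (s/2) * XF f c := by
          gcongr ?_ * _
          apply ENNReal.ofReal_le_ofReal; linarith [hs.1]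
      _ ≤ X0 f s c + ENNReal.ofReal (2/s) * AF f s :=
          contr sp (hs.2.trans h1) f hf N hN c
      _ ≤ _ := by
          gcongr ?_ + ?_ * _
          · exact lintegral_mono_set (Set.Icc_subset_Icc_right hs.2)
          · apply ENNReal.ofReal_le_ofReal
            rw [div_le_div_iff₀ sp h0]; linarith [hs.1]
  -- step 2: integrate in s
  have s2 : ∀ c, ENNReal.ofReal (h/8) * VF f * ENNReal.ofReal (h/2) ≤
      X0 f h c * ENNReal.ofReal (h/2) + ENNReal.ofReal (4/h) * (3 * dirF h f) := by
    intro c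
    have hv : volume (Set.Icc (h/2) h) = ENNReal.ofReal (h/2) := by
      rw [Real.volume_Icc]; congr 1; ring
    have := setLIntegral_mono' (μ := volume) measurableSet_Icc (s1 c)
    rw [setLIntegral_const, lintegral_add_left (by fun_prop), setLIntegral_const,
      lintegral_const_mul' _ _ (by simp), hv] at this
    exact this.trans (by gcongr; exact B1 h0 h1 f hf)
  -- step 3: integrate in c
  have s3 : ENNReal.ofReal (h/8) * VF f * ENNReal.ofReal (h/2) * ENNReal.ofReal h ≤
      3 * dirF h f * ENNReal.ofReal (h/2) +
        ENNReal.ofReal (4/h) * (3 * dirF h f) * ENNReal.ofReal h := by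
    have := lintegral_mono (μ := volume.restrict (Set.Icc 0 h)) (fun u => s2 (f u))
    rw [setLIntegral_const, lintegral_add_right _ (by fun_prop), setLIntegral_const,
      lintegral_mul_const' _ _ (by simp), Real.volume_Icc, sub_zero] at this
    exact this.trans (by gcongr; exact B2 h1 f hf)
  have e1 : ENNReal.ofReal (h/8) * VF f * ENNReal.ofReal (h/2) * ENNReal.ofReal h =
      ENNReal.ofReal (h^3/16) * VF f := by
    rw [show h^3/16 = h/8 * (h/2) * h by ring, ENNReal.ofReal_mul (by positivity),
      ENNReal.ofReal_mul (by positivity)]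
    ring
  have e2 : 3 * dirF h f * ENNReal.ofReal (h/2) +
        ENNReal.ofReal (4/h) * (3 * dirF h f) * ENNReal.ofReal h
      = ENNReal.ofReal (3 * (h/2) + 3 * (4/h*h)) * dirF h f := by
    rw [ENNReal.ofReal_add (by positivity) (by positivity), ENNReal.ofReal_mul (by positivity),
      ENNReal.ofReal_mul (by positivity), ENNReal.ofReal_mul (by positivity)]
    simp only [ENNReal.ofReal_ofNat]
    ring
  rw [e1, e2] at s3
  calc ENNReal.ofReal (1/300 * h ^ 4) * VF f
      ≤ ENNReal.ofReal (1/15 * (h^3/16)) * VF f := by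
        gcongr ?_ * _
        apply ENNReal.ofReal_le_ofReal
        have : 0 < h^3 := by positivity
        nlinarith
    _ = ENNReal.ofReal (1/15) * (ENNReal.ofReal (h^3/16) * VF f) := by
        rw [ENNReal.ofReal_mul (by positivity), mul_assoc]
    _ ≤ ENNReal.ofReal (1/15) * (ENNReal.ofReal (3 * (h/2) + 3 * (4/h*h)) * dirF h f) := by
        gcongr
    _ = ENNReal.ofReal (1/15 * (3 * (h/2) + 3 * (4/h*h))) * dirF h f := by
        rw [ENNReal.ofReal_mul (by positivity), mul_assoc]
    _ ≤ 1 * dirF h f := by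
        gcongr ?_ * _
        rw [← ENNReal.ofReal_one]
        apply ENNReal.ofReal_le_ofReal
        rw [div_mul_cancel₀ _ h0.ne']; linarith
    _ = _ := one_mul _

/-- Truncation. -/
noncomputable def clampF (f : ℝ → ℝ) (n : ℕ) (t : ℝ) : ℝ := max (-(n:ℝ)) (min n (f t))

lemma clamp_contr (f : ℝ → ℝ) (n : ℕ) (t u : ℝ) :
    (clampF f n t - clampF f n u)^2 ≤ (f t - f u)^2 := by
  apply sq_le_sq.2
  have h1 : |clampF f n t - clampF f n u| ≤ |min (n:ℝ) (f t) - min (n:ℝ) (f u)| := by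
    have := abs_max_sub_max_le_max (-(n:ℝ)) (min (n:ℝ) (f t)) (-(n:ℝ)) (min (n:ℝ) (f u))
    simpa [clampF] using this
  have h2 : |min (n:ℝ) (f t) - min (n:ℝ) (f u)| ≤ |f t - f u| := by
    have := abs_min_sub_min_le_max (n:ℝ) (f t) (n:ℝ) (f u)
    simpa using this
  exact h1.trans h2

lemma V_fatou (f : ℝ → ℝ) (hf : Measurable f) :
    VF f ≤ Filter.liminf (fun n => VF (clampF f n)) Filter.atTop := by
  unfold VF
  refine le_trans (lintegral_mono fun p => ?_) (lintegral_liminf_le fun n => ?_)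
  · apply le_of_eq
    symm
    apply Filter.Tendsto.liminf_eq
    apply tendsto_const_nhds.congr'
    obtain ⟨n, hn⟩ := exists_nat_ge (max |f p.1| |f p.2|)
    filter_upwards [Filter.eventually_ge_atTop n] with m hm
    have hm' : (n:ℝ) ≤ m := by exact_mod_cast hm
    have key : ∀ t, |f t| ≤ m → clampF f m t = f t := by
      intro t ht
      rw [clampF, min_eq_right (abs_le.1 ht).2, max_eq_right (abs_le.1 ht).1]
    rw [key _ ((le_max_left _ _).trans (hn.trans hm')), key _ ((le_max_right _ _).trans (hn.trans hm'))]
  · have : Measurable (clampF f n) := by unfold clampF; fun_prop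
    fun_prop

/-- Poincaré inequality on the half-line for the cusp random walk: the Dirichlet-form
quantity with weight `e^{-t-t'}` restricted to `|t − t'| ≤ h` dominates `C h⁴` times
the variance-type quantity with weight `e^{-2t-2t'}`. -/
theorem stmt_9 :
    ∃ C > (0 : ℝ), ∃ h₀ > (0 : ℝ), ∀ h ∈ Set.Ioc (0 : ℝ) h₀,
      ∀ f : ℝ → ℝ, Measurable f →
        ENNReal.ofReal (C * h ^ 4) *
          ∫⁻ p in {p : ℝ × ℝ | 0 ≤ p.1 ∧ 0 ≤ p.2},
            ENNReal.ofReal ((f p.1 - f p.2) ^ 2 * Real.exp (-2 * p.1 - 2 * p.2))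
              ∂(volume : Measure (ℝ × ℝ))
        ≤ ∫⁻ p in {p : ℝ × ℝ | 0 ≤ p.1 ∧ 0 ≤ p.2 ∧ |p.1 - p.2| ≤ h},
            ENNReal.ofReal ((f p.1 - f p.2) ^ 2 * Real.exp (-p.1 - p.2))
              ∂(volume : Measure (ℝ × ℝ)) := by
  refine ⟨1/300, by norm_num, 1, by norm_num, fun h hh f hf => ?_⟩
  rw [dirF_eq h f hf, ← VF]
  have hn : ∀ n, ENNReal.ofReal (1/300 * h ^ 4) * VF (clampF f n) ≤ dirF h f := by
    intro n
    have hm : Measurable (clampF f n) := by unfold clampF; fun_prop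
    refine (bdd_case hh.1 hh.2 _ hm n fun t => ?_).trans ?_
    · have : (0:ℝ) ≤ n := n.cast_nonneg
      rw [abs_le, clampF]
      exact ⟨le_max_left _ _, max_le (by linarith) (min_le_left _ _)⟩
    · refine lintegral_mono fun t => lintegral_mono fun u => ?_
      unfold dirInt
      apply Set.indicator_le_indicator
      apply ENNReal.ofReal_le_ofReal
      exact mul_le_mul_of_nonneg_right (clamp_contr f n _ _) (Real.exp_pos _).le
  have hpos : 0 < h := hh.1
  have hne : ENNReal.ofReal (1/300 * h ^ 4) ≠ 0 := by
    simp only [ne_eq, ENNReal.ofReal_eq_zero, not_le]; positivity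
  have hn' : ∀ n, VF (clampF f n) ≤ dirF h f / ENNReal.ofReal (1/300 * h ^ 4) := by
    intro n
    rw [ENNReal.le_div_iff_mul_le (Or.inl hne) (Or.inl ENNReal.ofReal_ne_top), mul_comm]
    exact hn n
  have : VF f ≤ dirF h f / ENNReal.ofReal (1/300 * h ^ 4) := by
    refine (V_fatou f hf).trans ?_
    refine (Filter.liminf_le_liminf (Filter.Eventually.of_forall hn')).trans ?_
    simp
  rw [ENNReal.le_div_iff_mul_le (Or.inl hne) (Or.inl ENNReal.ofReal_ne_top), mul_comm] at this
  exact this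
end

section
/- There exist C > 0 and h₀ > 0 such that for every h ∈ (0, h₀], every L ≥ 1, and every measurable function f : ℝ → ℝ vanishing outside [−L, L], ∬_{|t − t'| ≤ h} (f(t) − f(t'))² e^{-(|t| + |t'|)/2} dt dt' ≥ C h³ ∬_{t, t' ∈ [−L, L]} (f(t) − f(t'))² e^{-|t| - |t'|} dt dt'. -/
open MeasureTheory Real

lemma halfline (g : ℝ → ℝ) (hg : Measurable g) (M : ℝ) (hb : ∀ t, |g t| ≤ M) (a δ : ℝ)
    (h0 : 0 < δ) (h1 : δ ≤ 1) :
    ENNReal.ofReal (δ ^ 2) * ∫⁻ t in Set.Ioi a, ENNReal.ofReal (g t ^ 2 * exp (-t)) ≤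
      6 * (ENNReal.ofReal δ * (∫⁻ t in Set.Ioc a (a + δ), ENNReal.ofReal (g t ^ 2 * exp (-t))) +
        ∫⁻ t in Set.Ioi a, ENNReal.ofReal ((g (t + δ) - g t) ^ 2 * exp (-t))) := by
  have hsplit : ∫⁻ t in Set.Ioi a, ENNReal.ofReal (g t ^ 2 * exp (-t)) =
      (∫⁻ t in Set.Ioc a (a + δ), ENNReal.ofReal (g t ^ 2 * exp (-t))) +
      ∫⁻ t in Set.Ioi (a + δ), ENNReal.ofReal (g t ^ 2 * exp (-t)) := by
    rw [← lintegral_union measurableSet_Ioi]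
    · rw [Set.Ioc_union_Ioi_eq_Ioi (by linarith)]
    · exact Set.Ioc_disjoint_Ioi le_rfl
  have hfin : ∫⁻ t in Set.Ioi a, ENNReal.ofReal (g t ^ 2 * exp (-t)) ≠ ⊤ := by
    have hi : IntegrableOn (fun t => M ^ 2 * exp (-t)) (Set.Ioi a) :=
      (integrableOn_exp_neg_Ioi a).const_mul _
    refine ne_top_of_le_ne_top hi.lintegral_lt_top.ne (lintegral_mono fun t => ?_)
    apply ENNReal.ofReal_le_ofReal
    apply mul_le_mul_of_nonneg_right _ (exp_pos _).le
    exact sq_le_sq' (by linarith [neg_abs_le (g t), hb t]) (by linarith [le_abs_self (g t), hb t])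
  have hshift : ∫⁻ t in Set.Ioi a, ENNReal.ofReal (g (t + δ) ^ 2 * exp (-t)) =
      ENNReal.ofReal (exp δ) * ∫⁻ t in Set.Ioi (a + δ), ENNReal.ofReal (g t ^ 2 * exp (-t)) := by
    rw [← lintegral_const_mul _ (by fun_prop), ← lintegral_indicator measurableSet_Ioi,
      ← lintegral_indicator measurableSet_Ioi,
      ← lintegral_add_right_eq_self (μ := volume) ((Set.Ioi (a + δ)).indicator _) δ]
    congr 1
    ext t
    by_cases ht : a < t
    · rw [Set.indicator_of_mem (show t ∈ Set.Ioi a from ht),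
        Set.indicator_of_mem (show t + δ ∈ Set.Ioi (a + δ) by simpa using ht),
        ← ENNReal.ofReal_mul (exp_pos _).le]
      congr 1
      rw [show -t = δ + -(t + δ) by ring, exp_add]; ring_nf
    · rw [Set.indicator_of_notMem (show t ∉ Set.Ioi a from ht),
        Set.indicator_of_notMem (show t + δ ∉ Set.Ioi (a + δ) by simpa using ht)]
  have hpt : ∫⁻ t in Set.Ioi a, ENNReal.ofReal (g (t + δ) ^ 2 * exp (-t)) ≤
      ENNReal.ofReal (1 + δ / 2) * (∫⁻ t in Set.Ioi a, ENNReal.ofReal (g t ^ 2 * exp (-t))) +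
      ENNReal.ofReal (1 + 2 / δ) *
        ∫⁻ t in Set.Ioi a, ENNReal.ofReal ((g (t + δ) - g t) ^ 2 * exp (-t)) := by
    rw [← lintegral_const_mul _ (by fun_prop), ← lintegral_const_mul _ (by fun_prop),
      ← lintegral_add_left (by fun_prop)]
    refine lintegral_mono fun t => ?_
    dsimp only
    rw [← ENNReal.ofReal_mul (by positivity), ← ENNReal.ofReal_mul (by positivity),
      ← ENNReal.ofReal_add (by positivity) (by positivity)]
    apply ENNReal.ofReal_le_ofReal
    rw [← mul_assoc, ← mul_assoc, ← add_mul]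
    apply mul_le_mul_of_nonneg_right _ (exp_pos _).le
    generalize g (t + δ) = y
    generalize g t = x
    have key : (1 + δ / 2) * x ^ 2 + (1 + 2 / δ) * (y - x) ^ 2 - y ^ 2
        = (δ * x - 2 * (y - x)) ^ 2 / (2 * δ) := by
      field_simp; ring
    have : 0 ≤ (δ * x - 2 * (y - x)) ^ 2 / (2 * δ) := by positivity
    linarith
  rw [hshift] at hpt
  rw [hsplit] at hpt hfin ⊢
  generalize (∫⁻ t in Set.Ioc a (a + δ), ENNReal.ofReal (g t ^ 2 * exp (-t))) = S at *
  generalize (∫⁻ t in Set.Ioi (a + δ), ENNReal.ofReal (g t ^ 2 * exp (-t))) = P at *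
  generalize (∫⁻ t in Set.Ioi a, ENNReal.ofReal ((g (t + δ) - g t) ^ 2 * exp (-t))) = D at *
  by_cases hD : D = ⊤
  · subst hD; simp
  have hS : S ≠ ⊤ := fun h => hfin (by simp [h])
  have hP : P ≠ ⊤ := fun h => hfin (by simp [h])
  lift S to NNReal using hS
  lift P to NNReal using hP
  lift D to NNReal using hD
  have e : ∀ x : NNReal, (x : ENNReal) = ENNReal.ofReal (x : ℝ) := fun x => by simp
  have hS := S.coe_nonneg
  have hP := P.coe_nonneg
  have hD := D.coe_nonneg
  have e6 : (6 : ENNReal) = ENNReal.ofReal 6 := by norm_num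
  rw [e S, e P, e D] at *
  generalize (S : ℝ) = s at *
  generalize (P : ℝ) = p at *
  generalize (D : ℝ) = d at *
  rw [← ENNReal.ofReal_add hS hP, ← ENNReal.ofReal_mul (by positivity), ← ENNReal.ofReal_mul (by positivity),
    ← ENNReal.ofReal_mul (by positivity),
    ← ENNReal.ofReal_add (by positivity) (by positivity),
    ENNReal.ofReal_le_ofReal_iff (by positivity)] at hpt
  rw [e6, ← ENNReal.ofReal_add hS hP, ← ENNReal.ofReal_mul (by positivity), ← ENNReal.ofReal_mul (by positivity),
    ← ENNReal.ofReal_add (by positivity) (by positivity), ← ENNReal.ofReal_mul (by positivity),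
    ENNReal.ofReal_le_ofReal_iff (by positivity)]
  have h2 : (1 + δ) * p ≤ exp δ * p :=
    mul_le_mul_of_nonneg_right (by linarith [add_one_le_exp δ]) hP
  have h3 : δ / 2 * p ≤ (1 + δ / 2) * s + (1 + 2 / δ) * d := by linarith
  have h4 : 2 * δ * (δ / 2 * p) ≤ 2 * δ * ((1 + δ / 2) * s + (1 + 2 / δ) * d) :=
    mul_le_mul_of_nonneg_left h3 (by positivity)
  have h5 : 2 * δ * ((1 + δ / 2) * s + (1 + 2 / δ) * d) =
    2 * δ * s + δ * (δ * s) + 2 * (δ * d) + 4 * d := by field_simp; ring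
  have h6 : δ * (δ * s) ≤ δ * s := mul_le_of_le_one_left (by positivity) h1
  have h7 : δ * d ≤ d := mul_le_of_le_one_left (by positivity) h1
  have : 0 ≤ δ * s := by positivity
  nlinarith

noncomputable def Ker (f : ℝ → ℝ) (h t s : ℝ) : ENNReal :=
  if |t - s| ≤ h then ENNReal.ofReal ((f t - f s) ^ 2 * exp (-(|t| + |s|) / 2)) else 0

noncomputable def En (f : ℝ → ℝ) (h : ℝ) : ENNReal := ∫⁻ t, ∫⁻ s, Ker f h t s

lemma measurable_Ker (f : ℝ → ℝ) (hf : Measurable f) (h : ℝ) :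
    Measurable (fun p : ℝ × ℝ => Ker f h p.1 p.2) := by
  unfold Ker
  refine Measurable.ite (measurableSet_le (by fun_prop) (by fun_prop)) ?_ measurable_const
  fun_prop

lemma le_Ker (f : ℝ → ℝ) (h t s x : ℝ) (hts : |t - s| ≤ h) (hx : (|t| + |s|) / 2 ≤ 2 + x) :
    ENNReal.ofReal ((f t - f s) ^ 2 * exp (-x)) ≤ ENNReal.ofReal (exp 2) * Ker f h t s := by
  unfold Ker
  rw [if_pos hts, ← ENNReal.ofReal_mul (exp_pos _).le]
  apply ENNReal.ofReal_le_ofReal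
  rw [mul_left_comm, ← exp_add]
  gcongr
  linarith

lemma avg (N S D : ℝ → ENNReal) (mN : Measurable N) (mS : Measurable S) (mD : Measurable D)
    (h : ℝ) (X : ENNReal) (h0 : 0 < h) (h1 : h ≤ 1)
    (hA : ∀ u, ∀ δ ∈ Set.Ioc (h / 2) h,
      ENNReal.ofReal (h ^ 2 / 4) * N u ≤ 6 * (ENNReal.ofReal h * S u + D δ))
    (hS : ∫⁻ u in Set.Icc (-(h / 4)) (h / 4), S u ≤ X)
    (hD : ∫⁻ δ in Set.Ioc (h / 2) h, D δ ≤ X) :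
    ENNReal.ofReal (h ^ 2) * ∫⁻ u in Set.Icc (-(h / 4)) (h / 4), N u ≤ 48 * X := by
  have e6 : (6 : ENNReal) = ENNReal.ofReal 6 := by norm_num
  have e8 : (8 : ENNReal) = ENNReal.ofReal 8 := by norm_num
  have s1 : ∀ u, ENNReal.ofReal (h ^ 2 / 4) * N u * ENNReal.ofReal (h / 2) ≤
      6 * (ENNReal.ofReal h * S u * ENNReal.ofReal (h / 2) + X) := by
    intro u
    calc _ = ∫⁻ δ in Set.Ioc (h / 2) h, ENNReal.ofReal (h ^ 2 / 4) * N u := by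
          rw [setLIntegral_const, Real.volume_Ioc]; congr 2; ring
      _ ≤ ∫⁻ δ in Set.Ioc (h / 2) h, 6 * (ENNReal.ofReal h * S u + D δ) :=
          setLIntegral_mono' measurableSet_Ioc (hA u)
      _ = 6 * (ENNReal.ofReal h * S u * ENNReal.ofReal (h / 2) +
            ∫⁻ δ in Set.Ioc (h / 2) h, D δ) := by
          rw [lintegral_const_mul _ (by fun_prop), lintegral_add_left (by fun_prop),
            setLIntegral_const, Real.volume_Ioc]
          congr 4; ring
      _ ≤ _ := by gcongr
  have s2 : ENNReal.ofReal (h ^ 2 / 4) * (∫⁻ u in Set.Icc (-(h / 4)) (h / 4), N u) *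
      ENNReal.ofReal (h / 2) ≤
      6 * (ENNReal.ofReal h * X * ENNReal.ofReal (h / 2) + X * ENNReal.ofReal (h / 2)) := by
    calc _ = ∫⁻ u in Set.Icc (-(h / 4)) (h / 4),
          ENNReal.ofReal (h ^ 2 / 4) * N u * ENNReal.ofReal (h / 2) := by
          rw [lintegral_mul_const _ (by fun_prop), lintegral_const_mul _ mN]
      _ ≤ ∫⁻ u in Set.Icc (-(h / 4)) (h / 4),
          6 * (ENNReal.ofReal h * S u * ENNReal.ofReal (h / 2) + X) :=
          lintegral_mono fun u => s1 u
      _ = 6 * (ENNReal.ofReal h * (∫⁻ u in Set.Icc (-(h / 4)) (h / 4), S u) *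
            ENNReal.ofReal (h / 2) + X * ENNReal.ofReal (h / 2)) := by
          rw [lintegral_const_mul _ (by fun_prop), lintegral_add_left (by fun_prop),
            lintegral_mul_const _ (by fun_prop), lintegral_const_mul _ mS,
            setLIntegral_const, Real.volume_Icc]
          congr 4; ring
      _ ≤ _ := by gcongr
  generalize (∫⁻ u in Set.Icc (-(h / 4)) (h / 4), N u) = I at *
  calc ENNReal.ofReal (h ^ 2) * I
      = ENNReal.ofReal (8 / h) * (ENNReal.ofReal (h ^ 2 / 4) * I * ENNReal.ofReal (h / 2)) := by
        rw [mul_right_comm, ← ENNReal.ofReal_mul (by positivity), ← mul_assoc,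
          ← ENNReal.ofReal_mul (by positivity)]
        congr 2; field_simp; norm_num
    _ ≤ ENNReal.ofReal (8 / h) *
        (6 * (ENNReal.ofReal 1 * X * ENNReal.ofReal (h / 2) + X * ENNReal.ofReal (h / 2))) := by
        refine mul_le_mul_right (s2.trans ?_) _
        gcongr
    _ = 12 * (ENNReal.ofReal (8 / h) * ENNReal.ofReal (h / 2)) * X := by
        rw [ENNReal.ofReal_one]; ring
    _ = 48 * X := by
        rw [← ENNReal.ofReal_mul (by positivity), show 8 / h * (h / 2) = 4 by field_simp; norm_num]
        norm_num

lemma halfB (f : ℝ → ℝ) (hf : Measurable f) (M : ℝ) (hb : ∀ t, |f t| ≤ M) (h : ℝ)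
    (h0 : 0 < h) (h1 : h ≤ 1) :
    ENNReal.ofReal (h ^ 2) * ∫⁻ u in Set.Icc (-(h / 4)) (h / 4),
      ∫⁻ t in Set.Ioi (-(h / 4)), ENNReal.ofReal ((f t - f u) ^ 2 * exp (-t)) ≤
    ENNReal.ofReal (48 * exp 2) * En f h := by
  have hA : ∀ u, ∀ δ ∈ Set.Ioc (h / 2) h,
      ENNReal.ofReal (h ^ 2 / 4) *
        (∫⁻ t in Set.Ioi (-(h / 4)), ENNReal.ofReal ((f t - f u) ^ 2 * exp (-t))) ≤
      6 * (ENNReal.ofReal h *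
        (∫⁻ t in Set.Ioc (-(h / 4)) (3 * h / 4), ENNReal.ofReal ((f t - f u) ^ 2 * exp (-t))) +
        ∫⁻ t in Set.Ioi (-(h / 4)), ENNReal.ofReal ((f t - f (t + δ)) ^ 2 * exp (-t))) := by
    intro u δ hδ
    have := halfline (fun t => f t - f u) (by fun_prop) (M + M)
      (fun t => (abs_sub _ _).trans (add_le_add (hb _) (hb _))) (-(h / 4)) δ
      (by linarith [hδ.1]) (by linarith [hδ.2])
    refine le_trans ?_ (this.trans ?_)
    · gcongr
      nlinarith [hδ.1]
    · have e : ∀ t, (f (t + δ) - f u - (f t - f u)) ^ 2 = (f t - f (t + δ)) ^ 2 := fun t => by ring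
      simp only [e]
      gcongr
      · exact hδ.2
      · linarith [hδ.2]
  have hS : ∫⁻ u in Set.Icc (-(h / 4)) (h / 4),
      (∫⁻ t in Set.Ioc (-(h / 4)) (3 * h / 4), ENNReal.ofReal ((f t - f u) ^ 2 * exp (-t))) ≤
      ENNReal.ofReal (exp 2) * En f h := by
    calc _ ≤ ∫⁻ u in Set.Icc (-(h / 4)) (h / 4),
        (∫⁻ t in Set.Ioc (-(h / 4)) (3 * h / 4), ENNReal.ofReal (exp 2) * Ker f h u t) := by
          refine setLIntegral_mono' measurableSet_Icc fun u hu =>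
            setLIntegral_mono' measurableSet_Ioc fun t ht => ?_
          rw [← neg_sub, neg_sq]
          obtain ⟨hu1, hu2⟩ := hu
          obtain ⟨ht1, ht2⟩ := ht
          apply le_Ker
          · rw [abs_le]; constructor <;> linarith
          · have : |u| ≤ 1 := by rw [abs_le]; constructor <;> linarith
            have : |t| ≤ 1 := by rw [abs_le]; constructor <;> linarith
            linarith
      _ ≤ ∫⁻ u, ∫⁻ t, ENNReal.ofReal (exp 2) * Ker f h u t :=
          (setLIntegral_le_lintegral _ _).trans
            (lintegral_mono fun u => setLIntegral_le_lintegral _ _)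
      _ = _ := by
          unfold En
          rw [← lintegral_const_mul' _ _ ENNReal.ofReal_ne_top]
          congr 1; ext u
          rw [← lintegral_const_mul' _ _ ENNReal.ofReal_ne_top]
  have hD : ∫⁻ δ in Set.Ioc (h / 2) h,
      ∫⁻ t in Set.Ioi (-(h / 4)), ENNReal.ofReal ((f t - f (t + δ)) ^ 2 * exp (-t)) ≤
      ENNReal.ofReal (exp 2) * En f h := by
    calc _ ≤ ∫⁻ δ in Set.Ioc (h / 2) h,
        (∫⁻ t in Set.Ioi (-(h / 4)), ENNReal.ofReal (exp 2) * Ker f h t (t + δ)) := by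
          refine setLIntegral_mono' measurableSet_Ioc fun δ hδ =>
            setLIntegral_mono' measurableSet_Ioi fun t ht => ?_
          obtain ⟨hd1, hd2⟩ := hδ
          have ht : -(h / 4) < t := ht
          apply le_Ker
          · rw [abs_le]; constructor <;> linarith
          · have : |t| ≤ t + 1 := by rw [abs_le]; constructor <;> linarith
            have : |t + δ| ≤ t + 2 := by rw [abs_le]; constructor <;> linarith
            linarith
      _ ≤ ∫⁻ δ, ∫⁻ t, ENNReal.ofReal (exp 2) * Ker f h t (t + δ) :=
          (setLIntegral_le_lintegral _ _).trans
            (lintegral_mono fun u => setLIntegral_le_lintegral _ _)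
      _ = ∫⁻ t, ∫⁻ δ, ENNReal.ofReal (exp 2) * Ker f h t (t + δ) := by
          apply lintegral_lintegral_swap
          apply Measurable.aemeasurable
          exact ((measurable_Ker f hf h).comp
            (measurable_snd.prodMk (measurable_snd.add measurable_fst))).const_mul _
      _ = _ := by
          unfold En
          rw [← lintegral_const_mul' _ _ ENNReal.ofReal_ne_top]
          congr 1; ext t
          rw [← lintegral_const_mul' _ _ ENNReal.ofReal_ne_top]
          exact lintegral_add_left_eq_self (μ := volume)
            (fun s => ENNReal.ofReal (exp 2) * Ker f h t s) t
  have hmN : Measurable fun u =>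
      ∫⁻ t in Set.Ioi (-(h / 4)), ENNReal.ofReal ((f t - f u) ^ 2 * exp (-t)) := by
    apply Measurable.lintegral_prod_right' (f := fun p : ℝ × ℝ =>
      ENNReal.ofReal ((f p.2 - f p.1) ^ 2 * exp (-p.2)))
    fun_prop
  have hmS : Measurable fun u =>
      ∫⁻ t in Set.Ioc (-(h / 4)) (3 * h / 4), ENNReal.ofReal ((f t - f u) ^ 2 * exp (-t)) := by
    apply Measurable.lintegral_prod_right' (f := fun p : ℝ × ℝ =>
      ENNReal.ofReal ((f p.2 - f p.1) ^ 2 * exp (-p.2)))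
    fun_prop
  have hmD : Measurable fun δ =>
      ∫⁻ t in Set.Ioi (-(h / 4)), ENNReal.ofReal ((f t - f (t + δ)) ^ 2 * exp (-t)) := by
    apply Measurable.lintegral_prod_right' (f := fun p : ℝ × ℝ =>
      ENNReal.ofReal ((f p.2 - f (p.2 + p.1)) ^ 2 * exp (-p.2)))
    fun_prop
  have := avg _ _ _ hmN hmS hmD h _ h0 h1 hA hS hD
  rw [ENNReal.ofReal_mul (by norm_num), mul_assoc]
  simpa using this

lemma fullM (f : ℝ → ℝ) (hf : Measurable f) (M : ℝ) (hb : ∀ t, |f t| ≤ M) (h : ℝ)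
    (h0 : 0 < h) (h1 : h ≤ 1) :
    ENNReal.ofReal (h ^ 2) * ∫⁻ u in Set.Icc (-(h / 4)) (h / 4),
      ∫⁻ t, ENNReal.ofReal ((f t - f u) ^ 2 * exp (-|t|)) ≤
    ENNReal.ofReal (96 * exp 2) * En f h := by
  have B1 := halfB f hf M hb h h0 h1
  have B2 := halfB (fun t => f (-t)) (by fun_prop) M (fun t => hb _) h h0 h1
  have hE : En (fun t => f (-t)) h = En f h := by
    unfold En
    rw [← lintegral_neg_eq_self (μ := volume) (fun t => ∫⁻ s, Ker f h t s)]
    congr 1; ext t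
    rw [← lintegral_neg_eq_self (μ := volume) (fun s => Ker f h (-t) s)]
    congr 1; ext s
    unfold Ker
    rw [abs_neg, abs_neg, show -t - -s = -(t - s) by ring, abs_neg]
  have hJ : (∫⁻ u in Set.Icc (-(h / 4)) (h / 4),
      ∫⁻ t in Set.Ioi (-(h / 4)), ENNReal.ofReal ((f (-t) - f (-u)) ^ 2 * exp (-t))) =
      ∫⁻ u in Set.Icc (-(h / 4)) (h / 4),
      ∫⁻ t in Set.Iio (h / 4), ENNReal.ofReal ((f t - f u) ^ 2 * exp t) := by
    rw [← lintegral_indicator measurableSet_Icc, ← lintegral_indicator measurableSet_Icc,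
      ← lintegral_neg_eq_self]
    congr 1; ext u
    have hu : -u ∈ Set.Icc (-(h / 4)) (h / 4) ↔ u ∈ Set.Icc (-(h / 4)) (h / 4) := by
      simp only [Set.mem_Icc]; constructor <;> rintro ⟨_, _⟩ <;> constructor <;> linarith
    by_cases hu' : u ∈ Set.Icc (-(h / 4)) (h / 4)
    · rw [Set.indicator_of_mem hu', Set.indicator_of_mem (hu.2 hu'), neg_neg,
        ← lintegral_indicator measurableSet_Ioi, ← lintegral_indicator measurableSet_Iio,
        ← lintegral_neg_eq_self]
      congr 1; ext t
      by_cases ht : t < h / 4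
      · rw [Set.indicator_of_mem (show t ∈ Set.Iio (h / 4) from ht),
          Set.indicator_of_mem (show -t ∈ Set.Ioi (-(h / 4)) by simpa using ht), neg_neg]
      · rw [Set.indicator_of_notMem (show t ∉ Set.Iio (h / 4) from ht),
          Set.indicator_of_notMem (show -t ∉ Set.Ioi (-(h / 4)) by simpa using ht)]
    · rw [Set.indicator_of_notMem hu', Set.indicator_of_notMem (fun h => hu' (hu.1 h))]
  rw [hE, hJ] at B2
  have hmN : Measurable fun u =>
      ∫⁻ t in Set.Ioi (-(h / 4)), ENNReal.ofReal ((f t - f u) ^ 2 * exp (-t)) := by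
    apply Measurable.lintegral_prod_right' (f := fun p : ℝ × ℝ =>
      ENNReal.ofReal ((f p.2 - f p.1) ^ 2 * exp (-p.2)))
    fun_prop
  have hsum : ∫⁻ u in Set.Icc (-(h / 4)) (h / 4),
      ∫⁻ t, ENNReal.ofReal ((f t - f u) ^ 2 * exp (-|t|)) ≤
      (∫⁻ u in Set.Icc (-(h / 4)) (h / 4),
        ∫⁻ t in Set.Ioi (-(h / 4)), ENNReal.ofReal ((f t - f u) ^ 2 * exp (-t))) +
      ∫⁻ u in Set.Icc (-(h / 4)) (h / 4),
        ∫⁻ t in Set.Iio (h / 4), ENNReal.ofReal ((f t - f u) ^ 2 * exp t) := by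
    rw [← lintegral_add_left hmN]
    refine lintegral_mono fun u => ?_
    dsimp only
    rw [← setLIntegral_univ, ← show Set.Ioi (-(h / 4)) ∪ Set.Iio (h / 4) = Set.univ from
      Set.Ioi_union_Iio_of_lt (by linarith)]
    refine (lintegral_union_le _ _ _).trans (add_le_add ?_ ?_)
    · refine lintegral_mono fun t => ENNReal.ofReal_le_ofReal ?_
      gcongr
      exact le_abs_self t
    · refine lintegral_mono fun t => ENNReal.ofReal_le_ofReal ?_
      gcongr
      linarith [neg_abs_le t]
  calc _ ≤ ENNReal.ofReal (h ^ 2) * (_ + _) := by gcongr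
    _ ≤ _ := by
      rw [mul_add]
      refine (add_le_add B1 B2).trans ?_
      rw [← add_mul, ← ENNReal.ofReal_add (by positivity) (by positivity)]
      apply le_of_eq; congr 2; ring

lemma expabs : ∫⁻ t : ℝ, ENNReal.ofReal (exp (-|t|)) ≤ 2 := by
  have h1 : ∫⁻ t in Set.Ioi (0:ℝ), ENNReal.ofReal (exp (-|t|)) = 1 := by
    rw [setLIntegral_congr_fun (g := fun t => ENNReal.ofReal (exp (-t))) measurableSet_Ioi
      (fun t ht => by simp only [abs_of_pos (show 0 < t from ht)])]
    rw [← ofReal_integral_eq_lintegral_ofReal (integrableOn_exp_neg_Ioi 0)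
      (Filter.Eventually.of_forall fun t => (exp_pos _).le), integral_exp_neg_Ioi]
    simp
  have h2 : ∫⁻ t in Set.Iic (0:ℝ), ENNReal.ofReal (exp (-|t|)) = 1 := by
    rw [setLIntegral_congr_fun (g := fun t => ENNReal.ofReal (exp t)) measurableSet_Iic
      (fun t ht => by simp only [abs_of_nonpos (show t ≤ 0 from ht), neg_neg])]
    rw [← ofReal_integral_eq_lintegral_ofReal (integrableOn_exp_Iic 0)
      (Filter.Eventually.of_forall fun t => (exp_pos _).le), integral_exp_Iic]
    simp
  rw [← setLIntegral_univ, ← Set.Iic_union_Ioi (a := (0:ℝ))]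
  refine (lintegral_union_le _ _ _).trans ?_
  rw [h1, h2]; norm_num

lemma V_le_s10 (f : ℝ → ℝ) (hf : Measurable f) (u : ℝ) :
    ∫⁻ t, ∫⁻ s, ENNReal.ofReal ((f t - f s) ^ 2 * exp (-|t| - |s|)) ≤
      8 * ∫⁻ t, ENNReal.ofReal ((f t - f u) ^ 2 * exp (-|t|)) := by
  set A : ℝ → ENNReal := fun t => ENNReal.ofReal ((f t - f u) ^ 2 * exp (-|t|)) with hA
  set B : ℝ → ENNReal := fun t => ENNReal.ofReal (exp (-|t|)) with hB
  have mA : Measurable A := by fun_prop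
  have mB : Measurable B := by fun_prop
  calc _ ≤ ∫⁻ t, ∫⁻ s, (2 * A t * B s + 2 * B t * A s) := by
        refine lintegral_mono fun t => lintegral_mono fun s => ?_
        have e2 : (2 : ENNReal) = ENNReal.ofReal 2 := by norm_num
        simp only [hA, hB]
        rw [e2, ← ENNReal.ofReal_mul (by positivity), ← ENNReal.ofReal_mul (by positivity),
          ← ENNReal.ofReal_mul (by positivity), ← ENNReal.ofReal_mul (by positivity),
          ← ENNReal.ofReal_add (by positivity) (by positivity)]
        apply ENNReal.ofReal_le_ofReal
        rw [sub_eq_add_neg (-|t|), exp_add]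
        have : 0 ≤ (f t - f u + (f s - f u)) ^ 2 * (exp (-|t|) * exp (-|s|)) := by positivity
        nlinarith
    _ = 2 * (∫⁻ t, A t) * (∫⁻ t, B t) + 2 * (∫⁻ t, B t) * (∫⁻ t, A t) := by
        have : ∀ t, ∫⁻ s, (2 * A t * B s + 2 * B t * A s) =
            2 * A t * (∫⁻ s, B s) + 2 * B t * (∫⁻ s, A s) := fun t => by
          rw [lintegral_add_left (by fun_prop), lintegral_const_mul _ mB, lintegral_const_mul _ mA]
        simp only [this]
        rw [lintegral_add_left (by fun_prop), lintegral_mul_const _ (by fun_prop),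
          lintegral_mul_const _ (by fun_prop), lintegral_const_mul _ mB, lintegral_const_mul _ mA]
    _ ≤ 2 * (∫⁻ t, A t) * 2 + 2 * 2 * (∫⁻ t, A t) := by
        gcongr <;> exact expabs
    _ = _ := by ring

lemma boundedV (f : ℝ → ℝ) (hf : Measurable f) (M : ℝ) (hb : ∀ t, |f t| ≤ M) (h : ℝ)
    (h0 : 0 < h) (h1 : h ≤ 1) :
    ENNReal.ofReal (h ^ 3) * ∫⁻ t, ∫⁻ s, ENNReal.ofReal ((f t - f s) ^ 2 * exp (-|t| - |s|)) ≤
    ENNReal.ofReal (1536 * exp 2) * En f h := by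
  have h2 : (∫⁻ t, ∫⁻ s, ENNReal.ofReal ((f t - f s) ^ 2 * exp (-|t| - |s|))) *
      ENNReal.ofReal (h / 2) ≤ 8 * ∫⁻ u in Set.Icc (-(h / 4)) (h / 4),
      ∫⁻ t, ENNReal.ofReal ((f t - f u) ^ 2 * exp (-|t|)) := by
    rw [← lintegral_const_mul' _ _ (by norm_num)]
    calc _ = ∫⁻ u in Set.Icc (-(h / 4)) (h / 4),
        (∫⁻ t, ∫⁻ s, ENNReal.ofReal ((f t - f s) ^ 2 * exp (-|t| - |s|))) := by
          rw [setLIntegral_const, Real.volume_Icc]; congr 2; ring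
      _ ≤ _ := lintegral_mono fun u => V_le_s10 f hf u
  have h3 := fullM f hf M hb h h0 h1
  generalize (∫⁻ t, ∫⁻ s, ENNReal.ofReal ((f t - f s) ^ 2 * exp (-|t| - |s|))) = V at *
  generalize (∫⁻ u in Set.Icc (-(h / 4)) (h / 4),
      ∫⁻ t, ENNReal.ofReal ((f t - f u) ^ 2 * exp (-|t|))) = W at *
  have e2 : (2 : ENNReal) = ENNReal.ofReal 2 := by norm_num
  have e8 : (8 : ENNReal) = ENNReal.ofReal 8 := by norm_num
  calc _ = 2 * ENNReal.ofReal (h ^ 2) * (V * ENNReal.ofReal (h / 2)) := by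
        rw [mul_left_comm, e2, ← ENNReal.ofReal_mul (by norm_num),
          ← ENNReal.ofReal_mul (by positivity), mul_comm]
        congr 2; ring
    _ ≤ 2 * ENNReal.ofReal (h ^ 2) * (8 * W) := by gcongr
    _ = 2 * 8 * (ENNReal.ofReal (h ^ 2) * W) := by ring
    _ ≤ 2 * 8 * (ENNReal.ofReal (96 * exp 2) * En f h) := mul_le_mul_right h3 _
    _ = _ := by
        rw [e2, e8, ← ENNReal.ofReal_mul (by norm_num), ← mul_assoc,
          ← ENNReal.ofReal_mul (by norm_num)]
        congr 2; ring

lemma V_eq (f : ℝ → ℝ) (hf : Measurable f) :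
    ∫⁻ p : ℝ × ℝ, ENNReal.ofReal ((f p.1 - f p.2) ^ 2 * exp (-|p.1| - |p.2|)) =
    ∫⁻ t, ∫⁻ s, ENNReal.ofReal ((f t - f s) ^ 2 * exp (-|t| - |s|)) := by
  rw [Measure.volume_eq_prod, lintegral_prod _ (by fun_prop)]

lemma En_eq (f : ℝ → ℝ) (hf : Measurable f) (h : ℝ) :
    ∫⁻ p in {p : ℝ × ℝ | |p.1 - p.2| ≤ h},
      ENNReal.ofReal ((f p.1 - f p.2) ^ 2 * Real.exp (-(|p.1| + |p.2|) / 2)) = En f h := by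
  have hm : MeasurableSet {p : ℝ × ℝ | |p.1 - p.2| ≤ h} :=
    measurableSet_le (by fun_prop) (by fun_prop)
  rw [← lintegral_indicator hm]
  unfold En
  rw [Measure.volume_eq_prod, ← lintegral_prod (fun p : ℝ × ℝ => Ker f h p.1 p.2)
    (measurable_Ker f hf h).aemeasurable]
  congr 1

lemma trunc_sub (a b n : ℝ) :
    (max (-n) (min a n) - max (-n) (min b n)) ^ 2 ≤ (a - b) ^ 2 := by
  apply sq_le_sq.2
  refine (abs_max_sub_max_le_max _ _ _ _).trans ?_
  rw [sub_self, abs_zero, max_eq_right (abs_nonneg _)]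
  refine (abs_min_sub_min_le_max _ _ _ _).trans ?_
  rw [sub_self, abs_zero, max_eq_left (abs_nonneg _)]

lemma generalV (f : ℝ → ℝ) (hf : Measurable f) (h : ℝ) (h0 : 0 < h) (h1 : h ≤ 1) :
    ENNReal.ofReal (h ^ 3) *
      ∫⁻ p : ℝ × ℝ, ENNReal.ofReal ((f p.1 - f p.2) ^ 2 * exp (-|p.1| - |p.2|)) ≤
    ENNReal.ofReal (1536 * exp 2) * En f h := by
  set F : ℕ → ℝ → ℝ := fun n t => max (-(n : ℝ)) (min (f t) n) with hF
  have mF : ∀ n, Measurable (F n) := fun n => by fun_prop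
  have hpos : ENNReal.ofReal (h ^ 3) ≠ 0 := by simp; positivity
  have hn : ∀ n, ∫⁻ p : ℝ × ℝ, ENNReal.ofReal ((F n p.1 - F n p.2) ^ 2 * exp (-|p.1| - |p.2|)) ≤
      ENNReal.ofReal (1536 * exp 2) * En f h / ENNReal.ofReal (h ^ 3) := by
    intro n
    rw [ENNReal.le_div_iff_mul_le (Or.inl hpos) (Or.inl ENNReal.ofReal_ne_top), mul_comm,
      V_eq _ (mF n)]
    refine (boundedV (F n) (mF n) n (fun t => ?_) h h0 h1).trans ?_
    · have : (0 : ℝ) ≤ n := n.cast_nonneg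
      rw [abs_le]
      exact ⟨le_max_left _ _, max_le (by linarith) (min_le_right _ _)⟩
    · gcongr
      unfold En
      refine lintegral_mono fun t => lintegral_mono fun s => ?_
      unfold Ker
      split_ifs
      · apply ENNReal.ofReal_le_ofReal
        apply mul_le_mul_of_nonneg_right (trunc_sub _ _ _) (exp_pos _).le
      · exact le_rfl
  rw [mul_comm, ← ENNReal.le_div_iff_mul_le (Or.inl hpos) (Or.inl ENNReal.ofReal_ne_top)]
  have hlim : ∀ p : ℝ × ℝ, Filter.liminf (fun n =>
      ENNReal.ofReal ((F n p.1 - F n p.2) ^ 2 * exp (-|p.1| - |p.2|))) Filter.atTop =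
      ENNReal.ofReal ((f p.1 - f p.2) ^ 2 * exp (-|p.1| - |p.2|)) := by
    intro p
    apply Filter.Tendsto.liminf_eq
    apply tendsto_const_nhds.congr'
    obtain ⟨m, hm⟩ := exists_nat_ge (max |f p.1| |f p.2|)
    filter_upwards [Filter.eventually_ge_atTop m] with n hnm
    have hnm' : (m : ℝ) ≤ n := by exact_mod_cast hnm
    have key : ∀ t, |f t| ≤ n → F n t = f t := fun t ht => by
      obtain ⟨ha, hb⟩ := abs_le.1 ht
      simp only [hF]
      rw [min_eq_left hb, max_eq_right ha]
    rw [key _ (((le_max_left _ _).trans hm).trans hnm'),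
      key _ (((le_max_right _ _).trans hm).trans hnm')]
  simp only [← hlim]
  refine (lintegral_liminf_le fun n => by fun_prop).trans ?_
  refine (Filter.liminf_le_liminf (Filter.Eventually.of_forall hn)).trans ?_
  rw [Filter.liminf_const]

/-- Poincaré inequality, uniform in `L ≥ 1`, for the zero Fourier mode on `[−L, L]`:
the Dirichlet form with weight `e^{-(|t|+|t'|)/2}` restricted to `|t − t'| ≤ h`
dominates `C h³` times the variance with weight `e^{-|t|-|t'|}`. -/
theorem stmt_10 :
    ∃ C > (0 : ℝ), ∃ h₀ > (0 : ℝ), ∀ h ∈ Set.Ioc (0 : ℝ) h₀,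
      ∀ L : ℝ, 1 ≤ L →
        ∀ f : ℝ → ℝ, Measurable f → (∀ t : ℝ, t ∉ Set.Icc (-L) L → f t = 0) →
          ENNReal.ofReal (C * h ^ 3) *
            ∫⁻ p in Set.Icc (-L) L ×ˢ Set.Icc (-L) L,
              ENNReal.ofReal ((f p.1 - f p.2) ^ 2 * Real.exp (-|p.1| - |p.2|))
                ∂(volume : Measure (ℝ × ℝ))
          ≤ ∫⁻ p in {p : ℝ × ℝ | |p.1 - p.2| ≤ h},
              ENNReal.ofReal ((f p.1 - f p.2) ^ 2 * Real.exp (-(|p.1| + |p.2|) / 2))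
                ∂(volume : Measure (ℝ × ℝ)) := by
  refine ⟨(1536 * exp 2)⁻¹, by positivity, 1, one_pos, ?_⟩
  rintro h ⟨h0, h1⟩ L - f hf -
  rw [En_eq f hf h]
  have hg := generalV f hf h h0 h1
  calc _ ≤ ENNReal.ofReal ((1536 * exp 2)⁻¹ * h ^ 3) *
      ∫⁻ p : ℝ × ℝ, ENNReal.ofReal ((f p.1 - f p.2) ^ 2 * exp (-|p.1| - |p.2|)) := by
        gcongr
        exact Measure.restrict_le_self
    _ ≤ ENNReal.ofReal ((1536 * exp 2)⁻¹) * (ENNReal.ofReal (1536 * exp 2) * En f h) := by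
        rw [ENNReal.ofReal_mul (by positivity), mul_assoc]
        gcongr
    _ = En f h := by
        rw [← mul_assoc, ← ENNReal.ofReal_mul (by positivity),
          inv_mul_cancel₀ (by positivity), ENNReal.ofReal_one, one_mul]
end

section
/- Let t₀ ∈ ℝ, λ ≥ 1/4, and let u : [t₀, ∞) → ℂ be twice differentiable with u''(t) = (1/4 − λ) u(t) for all t ≥ t₀. If ∫_{t₀}^{∞} |u(t)|² dt < ∞, then u(t) = 0 for all t ≥ t₀. -/
open MeasureTheory Real Set

/-- An `L²` solution of `u'' = (1/4 − λ) u` on `[t₀, ∞)` with `λ ≥ 1/4` vanishes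
identically. -/
theorem stmt_15 (t₀ lam : ℝ) (hlam : 1 / 4 ≤ lam)
    (u u' : ℝ → ℂ)
    (hu : ∀ t ∈ Set.Ici t₀, HasDerivWithinAt u (u' t) (Set.Ici t₀) t)
    (hu' : ∀ t ∈ Set.Ici t₀,
      HasDerivWithinAt u' ((1 / 4 - (lam : ℂ)) * u t) (Set.Ici t₀) t)
    (hint : IntegrableOn (fun t => ‖u t‖ ^ 2) (Set.Ici t₀) volume) :
    ∀ t ∈ Set.Ici t₀, u t = 0 := by
  obtain ⟨m, hm⟩ : ∃ m : ℝ, m = lam - 1 / 4 := ⟨_, rfl⟩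
  have hm0 : 0 ≤ m := by linarith
  have hu2 : ∀ t ∈ Set.Ici t₀, HasDerivWithinAt u' ((-m) • u t) (Set.Ici t₀) t := by
    intro t ht
    convert hu' t ht using 1
    rw [hm, Complex.real_smul]; push_cast; ring
  have hf : ∀ t ∈ Set.Ici t₀, HasDerivWithinAt (fun t => ‖u t‖ ^ 2)
      (2 * inner ℝ (u t) (u' t)) (Set.Ici t₀) t := fun t ht => (hu t ht).norm_sq
  have hk : ∀ t ∈ Set.Ici t₀, HasDerivWithinAt (fun t => ‖u' t‖ ^ 2)
      (2 * inner ℝ (u' t) ((-m) • u t)) (Set.Ici t₀) t := fun t ht => (hu2 t ht).norm_sq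
  have hE : ∀ t ∈ Set.Ici t₀, HasDerivWithinAt (fun t => ‖u' t‖ ^ 2 + m * ‖u t‖ ^ 2)
      0 (Set.Ici t₀) t := by
    intro t ht
    refine ((hk t ht).add ((hf t ht).const_mul m)).congr_deriv ?_
    rw [inner_smul_right, real_inner_comm]; ring
  have hconst : ∀ (F : ℝ → ℝ), (∀ t ∈ Set.Ici t₀, HasDerivWithinAt F 0 (Set.Ici t₀) t) →
      ∀ t ∈ Set.Ici t₀, F t = F t₀ := by
    intro F hF t ht
    refine constant_of_has_deriv_right_zero (a := t₀) (b := t) ?_ ?_ t ⟨ht, le_rfl⟩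
    · exact fun x hx => ((hF x hx.1).continuousWithinAt).mono Icc_subset_Ici_self
    · exact fun x hx => (hF x hx.1).mono (Ici_subset_Ici.2 hx.1)
  have hEc := hconst _ hE
  obtain ⟨E, hEdef⟩ : ∃ E : ℝ, E = ‖u' t₀‖ ^ 2 + m * ‖u t₀‖ ^ 2 := ⟨_, rfl⟩
  simp only [← hEdef] at hEc
  have hg : ∀ t ∈ Set.Ici t₀, HasDerivWithinAt (fun t => inner ℝ (u t) (u' t))
      (E - 2 * m * ‖u t‖ ^ 2) (Set.Ici t₀) t := by
    intro t ht
    refine ((hu t ht).inner ℝ (hu2 t ht)).congr_deriv ?_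
    rw [inner_smul_right, real_inner_self_eq_norm_sq, real_inner_self_eq_norm_sq, ← hEc t ht]
    ring
  -- no lower bound by a positive constant near infinity
  have hno : ∀ (T c : ℝ), t₀ ≤ T → 0 < c → (∀ t, T ≤ t → c ≤ ‖u t‖ ^ 2) → False := by
    intro T c hT hc h
    have h1 : IntegrableOn (fun _ : ℝ => c) (Set.Ici T) volume := by
      refine Integrable.mono' (hint.mono_set (Ici_subset_Ici.2 hT)) (by fun_prop) ?_
      refine (ae_restrict_iff' measurableSet_Ici).2 (Filter.Eventually.of_forall fun t ht => ?_)
      rw [Real.norm_of_nonneg hc.le]; exact h t ht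
    rw [integrableOn_const_iff (by simp)] at h1
    simp [hc.ne'] at h1
  have hE0 : E = 0 := by
    by_contra hne
    have hEpos : 0 < E := lt_of_le_of_ne (by rw [hEdef]; positivity) (Ne.symm hne)
    set C := ∫ t in Set.Ici t₀, ‖u t‖ ^ 2 with hC
    have hglow : ∀ t, t₀ ≤ t →
        inner ℝ (u t₀) (u' t₀) + E * (t - t₀) - 2 * m * C ≤ inner ℝ (u t) (u' t) := by
      intro t ht
      have hfi : IntervalIntegrable (fun t => ‖u t‖ ^ 2) volume t₀ t :=
        (intervalIntegrable_iff_integrableOn_Icc_of_le ht).2 (hint.mono_set Icc_subset_Ici_self)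
      have h1 := intervalIntegral.integral_eq_sub_of_hasDerivAt_of_le ht
        (f := fun t => inner ℝ (u t) (u' t)) (f' := fun t => E - 2 * m * ‖u t‖ ^ 2)
        (fun x hx => ((hg x hx.1).continuousWithinAt).mono Icc_subset_Ici_self)
        (fun x hx => (hg x hx.1.le).hasDerivAt (Ici_mem_nhds hx.1))
        (intervalIntegrable_const.sub (hfi.const_mul _))
      rw [intervalIntegral.integral_sub intervalIntegrable_const (hfi.const_mul _),
        intervalIntegral.integral_const_mul, intervalIntegral.integral_const,
        smul_eq_mul] at h1
      have h2 : ∫ x in t₀..t, ‖u x‖ ^ 2 ≤ C := by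
        rw [intervalIntegral.integral_of_le ht]
        exact setIntegral_mono_set hint (Filter.Eventually.of_forall fun x => by positivity)
          (Filter.Eventually.of_forall fun x hx => le_of_lt hx.1)
      have h3 := mul_le_mul_of_nonneg_left h2 (by positivity : 0 ≤ 2 * m)
      linarith
    obtain ⟨T, hT, hTg⟩ : ∃ T, t₀ ≤ T ∧ ∀ t, T ≤ t → 1 ≤ inner ℝ (u t) (u' t) := by
      refine ⟨t₀ + |1 + 2 * m * C - inner ℝ (u t₀) (u' t₀)| / E, by
        have : 0 ≤ |1 + 2 * m * C - inner ℝ (u t₀) (u' t₀)| / E := by positivity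
        linarith, fun t ht => ?_⟩
      have h0 : |1 + 2 * m * C - inner ℝ (u t₀) (u' t₀)| / E ≤ t - t₀ := by linarith
      have h0' : 0 ≤ |1 + 2 * m * C - inner ℝ (u t₀) (u' t₀)| / E := by positivity
      rw [div_le_iff₀ hEpos] at h0
      have := hglow t (by linarith)
      have := le_abs_self (1 + 2 * m * C - inner ℝ (u t₀) (u' t₀))
      linarith
    refine hno (T + 1) 1 (by linarith) one_pos fun t ht => ?_
    have hd : ∀ x ∈ interior (Ici T), HasDerivAt (fun t => ‖u t‖ ^ 2)
        (2 * inner ℝ (u x) (u' x)) x := by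
      intro x hx
      rw [interior_Ici] at hx
      have : t₀ < x := lt_of_le_of_lt hT hx
      exact (hf x this.le).hasDerivAt (Ici_mem_nhds this)
    have := (convex_Ici T).mul_sub_le_image_sub_of_le_deriv (f := fun t => ‖u t‖ ^ 2) (C := 1)
      (fun x hx => ((hf x (le_trans hT hx)).continuousWithinAt).mono (Ici_subset_Ici.2 hT))
      (fun x hx => (hd x hx).differentiableAt.differentiableWithinAt)
      (fun x hx => by
        rw [(hd x hx).deriv]
        have := hTg x (interior_subset hx)
        linarith) T self_mem_Ici t (by simp only [mem_Ici]; linarith) (by linarith)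
    have h4 : 0 ≤ ‖u T‖ ^ 2 := by positivity
    linarith
  have hu0 : ∀ t ∈ Set.Ici t₀, u' t = 0 := by
    intro t ht
    have h1 := hEc t ht
    have h2 : 0 ≤ m * ‖u t‖ ^ 2 := by positivity
    have h3 : ‖u' t‖ ^ 2 = 0 := le_antisymm (by linarith) (by positivity)
    simpa using h3
  have hfc := hconst (fun t => ‖u t‖ ^ 2) fun t ht => by
    simpa [hu0 t ht] using hf t ht
  intro t ht
  by_contra hne
  refine hno t₀ (‖u t‖ ^ 2) le_rfl (by positivity) fun s hs => ?_
  have h1 := hfc t ht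
  have h2 := hfc s hs
  linarith
end

section
/- There exist C > 0 and h₀ > 0 such that for all h ∈ (0, h₀] and all s with 0 ≤ s ≤ sinh h, setting t_+ = log(cosh h + s) and t_- = log(cosh h − s), one has | (1 + t_+) e^{-t_+} − (1 + t_-) e^{-t_-} | ≤ C h³. -/
open Real

lemma aux_F (x : ℝ) (hx : |x| ≤ 1/2) :
    |(1 + Real.log (1 + x)) * Real.exp (-(Real.log (1 + x))) - (1 - x^2/2)| ≤ 5 * |x|^3 := by
  have h1 : |-x| < 1 := by rw [abs_neg]; linarith
  have h := Real.abs_log_sub_add_sum_range_le h1 2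
  simp only [Finset.sum_range_succ, Finset.sum_range_zero, abs_neg, sub_neg_eq_add] at h
  norm_num at h
  have hxx := abs_le.1 hx
  have hy : 0 < 1 + x := by linarith [hxx.1]
  have h3 : 0 ≤ |x|^3 := by positivity
  have h2 : |x|^3 / (1 - |x|) ≤ 2 * |x|^3 := by
    rw [div_le_iff₀ (by linarith)]
    nlinarith
  have h4 := abs_le.1 (h.trans h2)
  have h5 : |x^3| ≤ |x|^3 := by rw [abs_pow]
  have h6 := abs_le.1 h5
  rw [Real.exp_neg, Real.exp_log hy]
  have e : (1 + Real.log (1 + x)) * (1 + x)⁻¹ - (1 - x^2/2)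
      = (Real.log (1 + x) - x + x^2/2 + x^3/2) / (1 + x) := by
    field_simp
    ring
  rw [e, abs_div, abs_of_pos hy, div_le_iff₀ hy, abs_le]
  constructor <;> nlinarith [h4.1, h4.2, h6.1, h6.2, mul_nonneg h3 (by linarith [hxx.1] : 0 ≤ 1/2 + x)]

/-- For `h ∈ (0, h₀]` and `s ∈ [0, sinh h]`, with `t₊ = log(cosh h + s)` and
`t₋ = log(cosh h − s)`, one has `|(1 + t₊) e^{−t₊} − (1 + t₋) e^{−t₋}| ≤ C h³`. -/
theorem stmt_17 :
    ∃ C > (0 : ℝ), ∃ h₀ > (0 : ℝ), ∀ h ∈ Set.Ioc (0 : ℝ) h₀, ∀ s : ℝ,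
      0 ≤ s → s ≤ Real.sinh h →
        |(1 + Real.log (Real.cosh h + s)) * Real.exp (-(Real.log (Real.cosh h + s)))
          - (1 + Real.log (Real.cosh h - s)) * Real.exp (-(Real.log (Real.cosh h - s)))|
          ≤ C * h ^ 3 := by
  refine ⟨300, by norm_num, 1/6, by norm_num, ?_⟩
  rintro h ⟨h0, h1⟩ s hs0 hs
  have e1 := abs_le.1 (Real.abs_exp_sub_one_sub_id_le (x := h) (by rw [abs_of_pos h0]; linarith))
  have e2 := abs_le.1 (Real.abs_exp_sub_one_sub_id_le (x := -h)
    (by rw [abs_neg, abs_of_pos h0]; linarith))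
  rw [Real.sinh_eq] at hs
  have hc1 := Real.one_le_cosh h
  have hc2 : Real.cosh h - 1 ≤ h^2 := by rw [Real.cosh_eq]; nlinarith [e1.2, e2.2]
  have hs2 : s ≤ 2 * h := by nlinarith [e1.2, e2.1]
  obtain ⟨u, hu⟩ : ∃ u, u = Real.cosh h - 1 := ⟨_, rfl⟩
  have hc : Real.cosh h = 1 + u := by linarith
  rw [hc] at hc1 hc2 ⊢
  have hu0 : 0 ≤ u := by linarith
  have hu1 : u ≤ h^2 := by linarith
  have hp : |u + s| ≤ 3 * h := by rw [abs_le]; constructor <;> nlinarith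
  have hm : |u - s| ≤ 3 * h := by rw [abs_le]; constructor <;> nlinarith
  have a1 := aux_F (u + s) (by linarith)
  have a2 := aux_F (u - s) (by linarith)
  have p1 : |u + s|^3 ≤ (3*h)^3 := by gcongr
  have p2 : |u - s|^3 ≤ (3*h)^3 := by gcongr
  have p3 : u * s ≤ h^2 * (2 * h) := by gcongr
  have p4 : 0 ≤ u * s := by positivity
  rw [show 1 + u + s = 1 + (u + s) by ring, show 1 + u - s = 1 + (u - s) by ring]
  have b1 := abs_le.1 a1
  have b2 := abs_le.1 a2
  have h3 : 0 < h^3 := by positivity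
  rw [abs_le]
  constructor <;> nlinarith [b1.1, b1.2, b2.1, b2.2]
end

section
/- There exists ε > 0 such that for all real x ≠ 0, | sin(x)/x | ≤ 1 − ε min(x², 1). -/
open Real

theorem aux_pos (x : ℝ) (hx : 0 < x) :
    |Real.sin x / x| ≤ 1 - 1 / 40 * min (x ^ 2) 1 := by
  rw [abs_div, abs_of_pos hx, div_le_iff₀ hx]
  rcases le_total x 2 with h | h
  · have hy : |x / 2| ≤ 1 := by rw [abs_of_pos (by positivity)]; linarith
    have hb := (abs_le.1 (Real.sin_bound hy)).2
    rw [abs_of_pos (by positivity)] at hb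
    have h0 : 0 ≤ Real.sin (x / 2) :=
      Real.sin_nonneg_of_nonneg_of_le_pi (by positivity) (by linarith [Real.pi_gt_three])
    have hs : |Real.sin x| ≤ 2 * Real.sin (x / 2) := by
      have e : Real.sin x = 2 * Real.sin (x / 2) * Real.cos (x / 2) := by
        rw [← Real.sin_two_mul]; congr 1; ring
      rw [e, abs_mul, abs_of_nonneg (by positivity : 0 ≤ 2 * Real.sin (x / 2))]
      exact mul_le_of_le_one_right (by positivity) (Real.abs_cos_le_one _)
    have hm : x * min (x ^ 2) 1 ≤ x * x ^ 2 :=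
      mul_le_mul_of_nonneg_left (min_le_left _ _) hx.le
    have h5 : x ^ 3 * x ^ 2 ≤ x ^ 3 * 4 :=
      mul_le_mul_of_nonneg_left (by nlinarith) (by positivity)
    have h3 : 0 < x ^ 3 := by positivity
    nlinarith
  · have h1 := Real.abs_sin_le_one x
    have hm : x * min (x ^ 2) 1 ≤ x * 1 :=
      mul_le_mul_of_nonneg_left (min_le_right _ _) hx.le
    nlinarith

/-- Quantitative sinc bound: there is `ε > 0` with `|sin x / x| ≤ 1 − ε min(x², 1)`
for all real `x ≠ 0`. -/
theorem stmt_18 :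
    ∃ ε > (0 : ℝ), ∀ x : ℝ, x ≠ 0 →
      |Real.sin x / x| ≤ 1 - ε * min (x ^ 2) 1 := by
  refine ⟨1 / 40, by norm_num, fun x hx => ?_⟩
  rcases lt_or_gt_of_ne hx with h | h
  · simpa using aux_pos (-x) (by linarith)
  · exact aux_pos x h
end
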